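/- Let Ω₁, Ω₂ ⊂ ℝⁿ (n ≥ 2) be the base domains of the dumbbell family Ω_ε, with Ω₂ simply connected, λ₁(Ω₁) < λ₁(Ω₂), and suppose the (positive, L²-normalized) first Dirichlet eigenfunction φ₁^{Ω₁} of Ω₁ attains its maximum over Ω₁ at a unique point x₀. For each ε > 0 let φ_{1,ε} be a positive L²-normalized first Dirichlet eigenfunction of Ω_ε and let 𝓛(Ω_ε) = {x ∈ Ω_ε : φ_{1,ε}(x) = sup_{Ω_ε} φ_{1,ε}} be its set of maximum points. Then for every δ > 0 there exists ε' > 0 such that for all 0 < ε ≤ ε', 𝓛(Ω_ε) ⊆ B(x₀, δ), the open Euclidean ball of radius δ about x₀. -/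

import Mathlib

open Set MeasureTheory Metric Filter

noncomputable section

abbrev ESp (k : ℕ) : Type := EuclideanSpace ℝ (Fin k)

/-- The Laplacian of a real-valued function on Euclidean space,
as the sum of the second derivatives along the coordinate directions. -/
def lap {k : ℕ} (f : ESp k → ℝ) (x : ESp k) : ℝ :=
  ∑ i : Fin k, fderiv ℝ (fun y => fderiv ℝ f y (EuclideanSpace.single i 1)) x
      (EuclideanSpace.single i 1)

/-- First Dirichlet eigenvalue as the infimum of the Rayleigh quotient over
nonzero smooth compactly supported test functions. -/
def dirEig1 {k : ℕ} (U : Set (ESp k)) : ℝ :=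
  sInf { r : ℝ | ∃ u : ESp k → ℝ, ContDiff ℝ (⊤ : ℕ∞) u ∧ HasCompactSupport u ∧
    tsupport u ⊆ U ∧ u ≠ 0 ∧
    r = (∫ x in U, ‖fderiv ℝ u x‖ ^ 2) / (∫ x in U, u x ^ 2) }

/-- A first Dirichlet eigenfunction of `U`. -/
def IsFirstDirEigenfun {k : ℕ} (U : Set (ESp k)) (φ : ESp k → ℝ) : Prop :=
  (∃ x ∈ U, φ x ≠ 0) ∧ ContDiffOn ℝ 2 φ U ∧ ContinuousOn φ (closure U) ∧
  (∀ x ∈ U, lap φ x + dirEig1 U * φ x = 0) ∧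
  (∀ x ∈ frontier U, φ x = 0)

/-- A set has smooth boundary: it is the sublevel set of a smooth defining
function with nonvanishing differential on the boundary. -/
def HasSmoothBoundary {k : ℕ} (Ω : Set (ESp k)) : Prop :=
  ∃ f : ESp k → ℝ, ContDiff ℝ (⊤ : ℕ∞) f ∧ Ω = f ⁻¹' (Iio 0) ∧
    ∀ x ∈ frontier Ω, fderiv ℝ f x ≠ 0

/-- The Euclidean norm `|x'|` of the last `m+1` coordinates of `x ∈ ℝ^(m+2)`. -/
def primeNorm {m : ℕ} (x : ESp (m + 2)) : ℝ :=
  Real.sqrt (∑ i : Fin (m + 1), x i.succ ^ 2)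

/-- The data of the dumbbell construction: two bounded disjoint open base domains
`Ω₁, Ω₂ ⊂ ℝ^(m+2)` with smooth boundary and flat boundary portions at `x₁ = -1`
(resp. `x₁ = 1`), and a smooth bump profile `ρ`. -/
structure Dumbbell (m : ℕ) where
  Ω₁ : Set (ESp (m + 2))
  Ω₂ : Set (ESp (m + 2))
  ξ : ℝ
  ρ : ℝ → ℝ
  hξ : 0 < ξ
  open₁ : IsOpen Ω₁
  open₂ : IsOpen Ω₂
  bounded₁ : Bornology.IsBounded Ω₁
  bounded₂ : Bornology.IsBounded Ω₂
  disj : Disjoint Ω₁ Ω₂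
  smooth₁ : HasSmoothBoundary Ω₁
  smooth₂ : HasSmoothBoundary Ω₂
  flat₁ : closure Ω₁ ∩ {x | -1 ≤ x 0 ∧ primeNorm x < 3 * ξ}
        = {x | x 0 = -1 ∧ primeNorm x < 3 * ξ}
  flat₁' : {x : ESp (m + 2) | x 0 = -1 ∧ primeNorm x < 3 * ξ} ⊆ frontier Ω₁
  flat₂ : closure Ω₂ ∩ {x | x 0 ≤ 1 ∧ primeNorm x < 3 * ξ}
        = {x | x 0 = 1 ∧ primeNorm x < 3 * ξ}
  flat₂' : {x : ESp (m + 2) | x 0 = 1 ∧ primeNorm x < 3 * ξ} ⊆ frontier Ω₂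
  ρ_pos : ∀ q ∈ Set.Ioc (-2 : ℝ) 0, 0 < ρ q
  ρ_smooth : ContDiffOn ℝ (⊤ : ℕ∞) ρ (Set.Ioo (-2 : ℝ) 0)
  ρ_cont : ContinuousOn ρ (Set.Ioc (-2 : ℝ) 0)
  ρ_zero : ρ 0 = 2
  ρ_one : ∀ q ∈ Set.Ioo (-2 : ℝ) (-1 : ℝ), ρ q = 1

namespace Dumbbell

variable {m : ℕ} (d : Dumbbell m)

def Q1 (ε : ℝ) : Set (ESp (m + 2)) :=
  {x | -1 ≤ x 0 ∧ x 0 ≤ -1 + 2 * ε ∧ primeNorm x < ε * d.ρ ((-1 - x 0) / ε)}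

def Q2 (ε : ℝ) : Set (ESp (m + 2)) :=
  {x | 1 - 2 * ε ≤ x 0 ∧ x 0 ≤ 1 ∧ primeNorm x < ε * d.ρ ((x 0 - 1) / ε)}

def Lε (_d : Dumbbell m) (ε : ℝ) : Set (ESp (m + 2)) :=
  {x | -1 + 2 * ε ≤ x 0 ∧ x 0 ≤ 1 - 2 * ε ∧ primeNorm x < ε}

/-- The connector `Q_ε`. -/
def Q (ε : ℝ) : Set (ESp (m + 2)) := d.Q1 ε ∪ d.Lε ε ∪ d.Q2 ε

/-- The dumbbell domain `Ω_ε = Ω₁ ∪ Ω₂ ∪ Q_ε`. -/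
def Ωε (ε : ℝ) : Set (ESp (m + 2)) := d.Ω₁ ∪ d.Ω₂ ∪ d.Q ε

end Dumbbell

section

/-! ### The averaging kernel -/

/-- The kernel `(1 - |z|²)₊`. -/
def kerK {k : ℕ} (z : ESp k) : ℝ := max (1 - ‖z‖ ^ 2) 0

/-- The potential `(1 - |z|²)₊²` of the kernel: `∇ kerG = -4 z kerK`. -/
def kerG {k : ℕ} (z : ESp k) : ℝ := (max (1 - ‖z‖ ^ 2) 0) ^ 2

/-- The mass of `kerK`. -/
def massK (k : ℕ) : ℝ := ∫ z : ESp k, kerK z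

/-- The average of `f` around `x` at scale `r`, weighted by `kerK`. -/
def avg {k : ℕ} (f : ESp k → ℝ) (x : ESp k) (r : ℝ) : ℝ :=
  (∫ z : ESp k, f (x + r • z) * kerK z) / massK k

variable {k : ℕ}

lemma continuous_kerK : Continuous (kerK (k := k)) := by
  unfold kerK; fun_prop

lemma kerK_nonneg (z : ESp k) : 0 ≤ kerK z := le_max_right _ _

lemma kerK_le_one (z : ESp k) : kerK z ≤ 1 :=
  max_le (by nlinarith [sq_nonneg ‖z‖]) zero_le_one

lemma kerK_eq_zero {z : ESp k} (hz : 1 ≤ ‖z‖) : kerK z = 0 :=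
  max_eq_right (by nlinarith)

lemma norm_lt_one_of_kerK_ne_zero {z : ESp k} (hz : kerK z ≠ 0) : ‖z‖ < 1 := by
  by_contra h; exact hz (kerK_eq_zero (not_lt.1 h))

lemma hasCompactSupport_kerK : HasCompactSupport (kerK (k := k)) :=
  HasCompactSupport.intro (isCompact_closedBall 0 1) fun z hz => kerK_eq_zero (by
    simp only [mem_closedBall, dist_zero_right, not_le] at hz; exact hz.le)

lemma kerG_eq (z : ESp k) : kerG z = kerK z ^ 2 := rfl

lemma continuous_kerG : Continuous (kerG (k := k)) := continuous_kerK.pow 2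

lemma kerG_nonneg (z : ESp k) : 0 ≤ kerG z := sq_nonneg _

lemma hasCompactSupport_kerG : HasCompactSupport (kerG (k := k)) :=
  HasCompactSupport.intro (isCompact_closedBall 0 1) fun z hz => by
    rw [kerG_eq, kerK_eq_zero, zero_pow two_ne_zero]
    simp only [mem_closedBall, dist_zero_right, not_le] at hz; exact hz.le

lemma integrable_kerK : Integrable (kerK (k := k)) :=
  continuous_kerK.integrable_of_hasCompactSupport hasCompactSupport_kerK

lemma massK_pos : 0 < massK k := by
  refine continuous_kerK.integral_pos_of_hasCompactSupport_nonneg_nonzero hasCompactSupport_kerK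
    kerK_nonneg (x := 0) ?_
  simp [kerK]

lemma hasDerivAt_sq_max (s : ℝ) : HasDerivAt (fun s : ℝ => (max s 0) ^ 2) (2 * max s 0) s := by
  rcases lt_trichotomy s 0 with h | h | h
  · rw [max_eq_right h.le]
    refine ((hasDerivAt_const s (0 : ℝ)).congr_of_eventuallyEq ?_).congr_deriv (by simp)
    filter_upwards [Iio_mem_nhds h] with t ht
    simp [max_eq_right (mem_Iio.1 ht).le]
  · subst h
    rw [hasDerivAt_iff_isLittleO]
    have : (fun x' : ℝ => (max x' 0) ^ 2 - (max (0 : ℝ) 0) ^ 2 - (x' - 0) • (2 * max (0 : ℝ) 0))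
        =O[nhds 0] fun x : ℝ => x ^ 2 := by
      refine Asymptotics.IsBigO.of_bound 1 (Eventually.of_forall fun t => ?_)
      rcases le_total t 0 with h | h <;> simp [h, sq_nonneg]
    refine this.trans_isLittleO ?_
    simpa using (Asymptotics.isLittleO_pow_id (𝕜 := ℝ) (n := 2) (by norm_num))
  · rw [max_eq_left h.le]
    have : HasDerivAt (fun s : ℝ => s ^ 2) (2 * s) s := by simpa using hasDerivAt_pow 2 s
    refine this.congr_of_eventuallyEq ?_
    filter_upwards [Ioi_mem_nhds h] with t ht
    simp [max_eq_left (mem_Ioi.1 ht).le]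

lemma hasFDerivAt_kerG (z : ESp k) :
    HasFDerivAt kerG ((-4 * kerK z) • innerSL ℝ z) z := by
  have h1 : HasFDerivAt (fun z : ESp k => 1 - ‖z‖ ^ 2) (-(2 • innerSL ℝ z)) z := by
    simpa using ((hasStrictFDerivAt_norm_sq z).hasFDerivAt).const_sub 1
  have h2 := (hasDerivAt_sq_max (1 - ‖z‖ ^ 2)).comp_hasFDerivAt z h1
  refine h2.congr_fderiv ?_
  ext y
  simp [kerK]
  ring

lemma fderiv_kerG_apply (z y : ESp k) :
    fderiv ℝ kerG z y = -4 * kerK z * inner ℝ z y := by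
  simp [(hasFDerivAt_kerG z).fderiv]

/-- A continuous linear functional expressed through the coordinates of its argument. -/
lemma clm_eq_sum (l : ESp k →L[ℝ] ℝ) (z : ESp k) :
    l z = ∑ i, z i * l (EuclideanSpace.single i 1) := by
  conv_lhs => rw [← (EuclideanSpace.basisFun (Fin k) ℝ).sum_repr z]
  simp

lemma continuous_partial {w : ESp k → ℝ} (hw : ContDiff ℝ 1 w) (e : ESp k) :
    Continuous fun y => fderiv ℝ w y e :=
  (hw.continuous_fderiv (by norm_num)).clm_apply continuous_const

lemma contDiff_partial {w : ESp k → ℝ} (hw : ContDiff ℝ 2 w) (e : ESp k) :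
    ContDiff ℝ 1 fun y => fderiv ℝ w y e :=
  (hw.fderiv_right (m := 1) (by norm_num)).clm_apply contDiff_const

lemma continuous_lap {w : ESp k → ℝ} (hw : ContDiff ℝ 2 w) : Continuous (lap w) :=
  continuous_finsetSum _ fun _ _ => continuous_partial (contDiff_partial hw _) _

/-- Differentiation of weighted averages along an affine motion of the argument. -/
lemma hasDerivAt_integral_kerK {w : ESp k → ℝ} (hw : ContDiff ℝ 1 w) (hwc : HasCompactSupport w)
    (p q : ESp k → ESp k) (hp : Continuous p) (hq : Continuous q) (t : ℝ) :
    HasDerivAt (fun t : ℝ => ∫ z, w (p z + t • q z) * kerK z)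
      (∫ z, fderiv ℝ w (p z + t • q z) (q z) * kerK z) t := by
  have hcont : ∀ t : ℝ, Continuous fun z => w (p z + t • q z) * kerK z := fun t =>
    (hw.continuous.comp (hp.add (hq.const_smul t))).mul continuous_kerK
  have hcont' : ∀ t : ℝ, Continuous fun z => fderiv ℝ w (p z + t • q z) (q z) * kerK z := fun t =>
    (((hw.continuous_fderiv (by norm_num)).comp (hp.add (hq.const_smul t))).clm_apply hq).mul
      continuous_kerK
  obtain ⟨C, hC⟩ := (hw.continuous_fderiv (by norm_num)).bounded_above_of_compact_support
    (hwc.fderiv (𝕜 := ℝ))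
  have hC0 : 0 ≤ C := (norm_nonneg _).trans (hC 0)
  refine (hasDerivAt_integral_of_dominated_loc_of_deriv_le (s := univ)
    (bound := fun z => C * ‖q z‖ * kerK z)
    (F' := fun t z => fderiv ℝ w (p z + t • q z) (q z) * kerK z) Filter.univ_mem
    (Eventually.of_forall fun t => (hcont t).aestronglyMeasurable) ?_
    (hcont' t).aestronglyMeasurable ?_ ?_ ?_).2
  · exact (hcont t).integrable_of_hasCompactSupport hasCompactSupport_kerK.mul_left
  · refine Eventually.of_forall fun z t _ => ?_
    rw [norm_mul, Real.norm_of_nonneg (kerK_nonneg z)]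
    refine mul_le_mul_of_nonneg_right ?_ (kerK_nonneg z)
    exact ((fderiv ℝ w _).le_opNorm _).trans
      (mul_le_mul_of_nonneg_right (hC _) (norm_nonneg _))
  · exact ((continuous_const.mul hq.norm).mul continuous_kerK).integrable_of_hasCompactSupport
      hasCompactSupport_kerK.mul_left
  · refine Eventually.of_forall fun z t _ => ?_
    refine HasDerivAt.mul_const ?_ _
    have h1 : HasDerivAt (fun t : ℝ => p z + t • q z) (q z) t := by
      simpa using ((hasDerivAt_id t).smul_const (q z)).const_add (p z)
    exact ((hw.differentiable (by norm_num)) _).hasFDerivAt.comp_hasDerivAt t h1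

lemma integral_radial_eq {w : ESp k → ℝ} (hw : ContDiff ℝ 2 w) (x : ESp k) (t : ℝ) :
    ∫ z, fderiv ℝ w (x + t • z) z * kerK z = t / 4 * ∫ z, lap w (x + t • z) * kerG z := by
  have hsh : ContDiff ℝ 1 fun z : ESp k => x + t • z := by fun_prop
  have key : ∀ i : Fin k, ∫ z : ESp k, fderiv ℝ w (x + t • z) (EuclideanSpace.single i 1) *
        fderiv ℝ kerG z (EuclideanSpace.single i 1)
      = - ∫ z : ESp k, (t * fderiv ℝ (fun y => fderiv ℝ w y (EuclideanSpace.single i 1)) (x + t • z)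
          (EuclideanSpace.single i 1)) * kerG z := by
    intro i
    have hP : ContDiff ℝ 1 fun z : ESp k => fderiv ℝ w (x + t • z) (EuclideanSpace.single i 1) :=
      (contDiff_partial hw _).comp hsh
    have hd : ∀ z : ESp k, fderiv ℝ (fun z : ESp k => fderiv ℝ w (x + t • z)
        (EuclideanSpace.single i 1)) z (EuclideanSpace.single i 1) =
        t * fderiv ℝ (fun y => fderiv ℝ w y (EuclideanSpace.single i 1)) (x + t • z)
          (EuclideanSpace.single i 1) := by
      intro z
      have h1 : HasFDerivAt (fun z : ESp k => x + t • z) (t • ContinuousLinearMap.id ℝ (ESp k)) z :=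
        ((hasFDerivAt_id z).const_smul t).const_add x
      have h2 := (((contDiff_partial hw (EuclideanSpace.single i 1)).differentiable
        (by norm_num)) (x + t • z)).hasFDerivAt.comp z h1
      have h3 := h2.fderiv
      simp only [Function.comp_def] at h3
      rw [h3]; simp
    simp_rw [← hd]
    have hdG : (fun z : ESp k => fderiv ℝ kerG z (EuclideanSpace.single i 1)) =
        fun z => -4 * kerK z * inner ℝ z (EuclideanSpace.single i 1) :=
      funext fun z => fderiv_kerG_apply z _
    refine integral_mul_fderiv_eq_neg_fderiv_mul_of_integrable ?_ ?_ ?_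
      (fun z _ => (hP.differentiable (by norm_num)) z)
      (fun z _ => (hasFDerivAt_kerG z).differentiableAt)
    · exact ((continuous_partial hP _).mul continuous_kerG).integrable_of_hasCompactSupport
        hasCompactSupport_kerG.mul_left
    · refine (hP.continuous.mul ?_).integrable_of_hasCompactSupport
        (hasCompactSupport_kerG.fderiv_apply (𝕜 := ℝ) _).mul_left
      rw [hdG]
      exact (continuous_const.mul continuous_kerK).mul (by fun_prop)
    · exact (hP.continuous.mul continuous_kerG).integrable_of_hasCompactSupport
        hasCompactSupport_kerG.mul_left
  have hInt : ∀ i : Fin k, Integrable fun z : ESp k =>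
      fderiv ℝ w (x + t • z) (EuclideanSpace.single i 1) *
        fderiv ℝ kerG z (EuclideanSpace.single i 1) := by
    intro i
    have hdG : (fun z : ESp k => fderiv ℝ kerG z (EuclideanSpace.single i 1)) =
        fun z => -4 * kerK z * inner ℝ z (EuclideanSpace.single i 1) :=
      funext fun z => fderiv_kerG_apply z _
    refine (Continuous.mul ((contDiff_partial hw _).comp hsh).continuous
      ?_).integrable_of_hasCompactSupport (hasCompactSupport_kerG.fderiv_apply (𝕜 := ℝ) _).mul_left
    rw [hdG]
    exact (continuous_const.mul continuous_kerK).mul (by fun_prop)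
  have hint2 : ∀ i : Fin k, Integrable fun z : ESp k =>
      (t * fderiv ℝ (fun y => fderiv ℝ w y (EuclideanSpace.single i 1)) (x + t • z)
          (EuclideanSpace.single i 1)) * kerG z := by
    intro i
    refine (Continuous.mul (continuous_const.mul ((continuous_partial (contDiff_partial hw _) _).comp
      hsh.continuous)) continuous_kerG).integrable_of_hasCompactSupport
      hasCompactSupport_kerG.mul_left
  have e1 : ∀ z : ESp k, fderiv ℝ w (x + t • z) z * kerK z = (-1 / 4) *
      ∑ i, fderiv ℝ w (x + t • z) (EuclideanSpace.single i 1) *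
        fderiv ℝ kerG z (EuclideanSpace.single i 1) := by
    intro z
    rw [clm_eq_sum (fderiv ℝ w (x + t • z)) z, Finset.sum_mul, Finset.mul_sum]
    refine Finset.sum_congr rfl fun i _ => ?_
    rw [fderiv_kerG_apply, EuclideanSpace.inner_single_right]
    simp
    ring
  have e2 : ∀ z : ESp k, lap w (x + t • z) * kerG z * t =
      ∑ i, (t * fderiv ℝ (fun y => fderiv ℝ w y (EuclideanSpace.single i 1)) (x + t • z)
          (EuclideanSpace.single i 1)) * kerG z := by
    intro z
    rw [lap, Finset.sum_mul, Finset.sum_mul]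
    exact Finset.sum_congr rfl fun i _ => by ring
  have e3 : t * ∫ z, lap w (x + t • z) * kerG z = ∑ i, ∫ z : ESp k,
      (t * fderiv ℝ (fun y => fderiv ℝ w y (EuclideanSpace.single i 1)) (x + t • z)
          (EuclideanSpace.single i 1)) * kerG z := by
    rw [← integral_finsetSum _ fun i _ => hint2 i, mul_comm, ← integral_mul_const]
    exact integral_congr_ae (Eventually.of_forall e2)
  rw [integral_congr_ae (Eventually.of_forall e1), integral_const_mul,
    integral_finsetSum _ fun i _ => hInt i, Finset.sum_congr rfl fun i _ => key i,
    Finset.sum_neg_distrib, ← e3]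
  ring

/-- The constant in the approximate mean value inequality. -/
def meanC (k : ℕ) : ℝ := (∫ z : ESp k, kerG z) / (4 * massK k)

lemma meanC_nonneg : 0 ≤ meanC k :=
  div_nonneg (integral_nonneg kerG_nonneg) (by have := massK_pos (k := k); positivity)

/-- Mean value inequality for functions with Laplacian bounded from below. -/
lemma le_avg_add {w : ESp k → ℝ} (hw : ContDiff ℝ 2 w) (hwc : HasCompactSupport w)
    {x : ESp k} {r A : ℝ} (hr : 0 ≤ r) (hA : 0 ≤ A)
    (h : ∀ y ∈ closedBall x r, -A ≤ lap w y) : w x ≤ avg w x r + A * meanC k * r ^ 2 := by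
  set g : ℝ → ℝ := fun t => ∫ z : ESp k, w (x + t • z) * kerK z with hg
  have hd : ∀ t, HasDerivAt g (t / 4 * ∫ z, lap w (x + t • z) * kerG z) t := by
    intro t
    rw [← integral_radial_eq hw]
    exact hasDerivAt_integral_kerK (hw.of_le (by norm_num)) hwc (fun _ => x) id
      continuous_const continuous_id t
  have hbound : ∀ t ∈ Icc 0 r, -(r / 4 * (A * ∫ z : ESp k, kerG z)) ≤
      t / 4 * ∫ z, lap w (x + t • z) * kerG z := by
    intro t ht
    have h1 : -(A * ∫ z : ESp k, kerG z) ≤ ∫ z, lap w (x + t • z) * kerG z := by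
      rw [← integral_const_mul, ← integral_neg]
      refine integral_mono
        ((continuous_const.mul continuous_kerG).integrable_of_hasCompactSupport
          hasCompactSupport_kerG.mul_left).neg
        ((((continuous_lap hw).comp (by fun_prop)).mul
          continuous_kerG).integrable_of_hasCompactSupport hasCompactSupport_kerG.mul_left) ?_
      intro z
      by_cases hz : kerK z = 0
      · simp [kerG_eq, hz]
      · have hz1 := norm_lt_one_of_kerK_ne_zero hz
        have := h (x + t • z) (by
          simp only [mem_closedBall, dist_self_add_left, norm_smul, Real.norm_of_nonneg ht.1]
          nlinarith [ht.1, ht.2, norm_nonneg z])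
        simp only
        nlinarith [kerG_nonneg z]
    have h2 : 0 ≤ A * ∫ z : ESp k, kerG z := mul_nonneg hA (integral_nonneg kerG_nonneg)
    nlinarith [ht.1, ht.2]
  have hmv := (convex_Icc (0 : ℝ) r).mul_sub_le_image_sub_of_le_deriv
    (f := g) (fun t _ => (hd t).continuousAt.continuousWithinAt)
    (fun t _ => (hd t).differentiableAt.differentiableWithinAt)
    (C := -(r / 4 * (A * ∫ z : ESp k, kerG z)))
    (fun t ht => by rw [(hd t).deriv]; exact hbound t (interior_subset ht))
    0 (left_mem_Icc.2 hr) r (right_mem_Icc.2 hr) hr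
  have hg0 : g 0 = w x * massK k := by simp [hg, massK, integral_const_mul]
  have hgr : avg w x r = g r / massK k := rfl
  have hm := massK_pos (k := k)
  rw [hgr, meanC]
  rw [hg0] at hmv
  have : w x = w x * massK k / massK k := by field_simp
  rw [this]
  have e : g r / massK k + A * ((∫ z : ESp k, kerG z) / (4 * massK k)) * r ^ 2 =
      (g r + r / 4 * (A * ∫ z : ESp k, kerG z) * r) / massK k := by field_simp
  rw [e]
  gcongr
  linarith

/-! ### Smooth truncation -/

/-- A smooth convex approximation of `s ↦ (s - η)₊` with slope in `[0, 1]`. -/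
def trunc (η s : ℝ) : ℝ := ∫ t in (0 : ℝ)..s, Real.smoothTransition ((t - η) / η)

lemma continuous_truncSlope (η : ℝ) :
    Continuous fun t : ℝ => Real.smoothTransition ((t - η) / η) :=
  Real.smoothTransition.continuous.comp (by fun_prop)

lemma hasDerivAt_trunc (η s : ℝ) :
    HasDerivAt (trunc η) (Real.smoothTransition ((s - η) / η)) s :=
  intervalIntegral.integral_hasDerivAt_right ((continuous_truncSlope η).intervalIntegrable _ _)
    (continuous_truncSlope η).aestronglyMeasurable.stronglyMeasurableAtFilter
    (continuous_truncSlope η).continuousAt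

lemma deriv_trunc (η : ℝ) :
    deriv (trunc η) = fun s => Real.smoothTransition ((s - η) / η) :=
  funext fun s => (hasDerivAt_trunc η s).deriv

lemma contDiff_truncSlope (η : ℝ) :
    ContDiff ℝ 1 fun t : ℝ => Real.smoothTransition ((t - η) / η) :=
  (Real.smoothTransition.contDiff (n := 1)).comp (by fun_prop)

lemma contDiff_trunc (η : ℝ) : ContDiff ℝ 2 (trunc η) := by
  have : ContDiff ℝ (1 + 1) (trunc η) := by
    rw [contDiff_succ_iff_deriv]
    refine ⟨fun s => (hasDerivAt_trunc η s).differentiableAt, by simp, ?_⟩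
    rw [deriv_trunc]
    exact contDiff_truncSlope η
  simpa [one_add_one_eq_two] using this

lemma truncSlope_eq_zero {η s : ℝ} (hη : 0 < η) (hs : s ≤ η) :
    Real.smoothTransition ((s - η) / η) = 0 :=
  Real.smoothTransition.zero_of_nonpos (div_nonpos_of_nonpos_of_nonneg (by linarith) hη.le)

lemma deriv_truncSlope_nonneg {η : ℝ} (hη : 0 < η) (s : ℝ) :
    0 ≤ deriv (fun t : ℝ => Real.smoothTransition ((t - η) / η)) s := by
  apply Monotone.deriv_nonneg
  intro a b hab
  exact Real.smoothTransition.monotone (by gcongr)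

lemma trunc_eq_zero {η s : ℝ} (hη : 0 < η) (hs : s ≤ η) : trunc η s = 0 := by
  rw [trunc, intervalIntegral.integral_congr (g := fun _ => (0 : ℝ)), intervalIntegral.integral_zero]
  intro t ht
  refine truncSlope_eq_zero hη ?_
  rw [mem_uIcc] at ht
  rcases ht with h | h <;> linarith [h.1, h.2]

lemma trunc_mono (η : ℝ) : Monotone (trunc η) :=
  monotone_of_deriv_nonneg (fun s => (hasDerivAt_trunc η s).differentiableAt)
    fun s => by rw [deriv_trunc]; exact Real.smoothTransition.nonneg _

lemma trunc_nonneg {η : ℝ} (hη : 0 < η) (s : ℝ) : 0 ≤ trunc η s := by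
  rcases le_total s η with h | h
  · exact (trunc_eq_zero hη h).ge
  · exact (trunc_eq_zero hη le_rfl).ge.trans (trunc_mono η h)

lemma trunc_le {η s : ℝ} (hs : 0 ≤ s) : trunc η s ≤ s := by
  have := intervalIntegral.integral_mono_on hs ((continuous_truncSlope η).intervalIntegrable _ _)
    (continuous_const.intervalIntegrable (μ := volume) 0 s)
    (fun t _ => Real.smoothTransition.le_one ((t - η) / η))
  simpa [trunc] using this

lemma sub_le_trunc {η : ℝ} (hη : 0 < η) (s : ℝ) : s - 2 * η ≤ trunc η s := by
  rcases le_total s (2 * η) with h | h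
  · linarith [trunc_nonneg hη s]
  · have h1 : trunc η (2 * η) + ∫ t in (2 * η)..s, Real.smoothTransition ((t - η) / η) =
        trunc η s :=
      intervalIntegral.integral_add_adjacent_intervals
        ((continuous_truncSlope η).intervalIntegrable _ _)
        ((continuous_truncSlope η).intervalIntegrable _ _)
    have h2 : ∫ t in (2 * η)..s, Real.smoothTransition ((t - η) / η) = s - 2 * η := by
      rw [intervalIntegral.integral_congr (g := fun _ => (1 : ℝ))]
      · simp
      · intro t ht
        rw [uIcc_of_le h] at ht
        refine Real.smoothTransition.one_of_one_le ?_
        rw [le_div_iff₀ hη]; linarith [ht.1]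
    linarith [trunc_nonneg hη (2 * η)]

/-- The squared norm of the gradient. -/
def gradSq (w : ESp k → ℝ) (x : ESp k) : ℝ :=
  ∑ i, (fderiv ℝ w x (EuclideanSpace.single i 1)) ^ 2

lemma gradSq_nonneg (w : ESp k → ℝ) (x : ESp k) : 0 ≤ gradSq w x :=
  Finset.sum_nonneg fun _ _ => sq_nonneg _

lemma continuous_gradSq {w : ESp k → ℝ} (hw : ContDiff ℝ 1 w) : Continuous (gradSq w) :=
  continuous_finsetSum _ fun _ _ => (continuous_partial hw _).pow 2

lemma norm_fderiv_sq (w : ESp k → ℝ) (x : ESp k) : ‖fderiv ℝ w x‖ ^ 2 = gradSq w x := by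
  have h := (InnerProductSpace.toDual ℝ (ESp k)).symm.norm_map (fderiv ℝ w x)
  rw [← h, EuclideanSpace.norm_sq_eq, gradSq]
  refine Finset.sum_congr rfl fun i _ => ?_
  have : fderiv ℝ w x (EuclideanSpace.single i 1) = inner ℝ
      ((InnerProductSpace.toDual ℝ (ESp k)).symm (fderiv ℝ w x)) (EuclideanSpace.single i 1) := by
    simp
  rw [this, EuclideanSpace.inner_single_right]
  simp

lemma gradSq_eq_zero_of_notMem {w : ESp k → ℝ} {x : ESp k} (hx : x ∉ tsupport w) :
    gradSq w x = 0 := by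
  have : fderiv ℝ w x = 0 := by
    by_contra h
    exact hx (support_fderiv_subset ℝ (Function.mem_support.2 h))
  simp [gradSq, this]

lemma hasCompactSupport_gradSq {w : ESp k → ℝ} (hwc : HasCompactSupport w) :
    HasCompactSupport (gradSq w) :=
  HasCompactSupport.intro hwc.isCompact fun _ hx => gradSq_eq_zero_of_notMem hx

lemma integrable_gradSq {w : ESp k → ℝ} (hw : ContDiff ℝ 1 w) (hwc : HasCompactSupport w) :
    Integrable (gradSq w) :=
  (continuous_gradSq hw).integrable_of_hasCompactSupport (hasCompactSupport_gradSq hwc)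

lemma hasCompactSupport_sq {w : ESp k → ℝ} (hwc : HasCompactSupport w) :
    HasCompactSupport fun x => w x ^ 2 :=
  HasCompactSupport.intro hwc.isCompact fun x hx => by
    rw [image_eq_zero_of_notMem_tsupport hx, zero_pow two_ne_zero]

lemma integral_gradSq {w : ESp k → ℝ} (hw : ContDiff ℝ 2 w) (hwc : HasCompactSupport w) :
    ∫ x, gradSq w x = ∫ x, -(w x * lap w x) := by
  have hw1 : ContDiff ℝ 1 w := hw.of_le (by norm_num)
  have hI1 : ∀ i : Fin k, Integrable fun x => (fderiv ℝ w x (EuclideanSpace.single i 1)) ^ 2 :=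
    fun i => ((continuous_partial hw1 _).pow 2).integrable_of_hasCompactSupport
      (hasCompactSupport_sq (hwc.fderiv_apply (𝕜 := ℝ) _))
  have hI2 : ∀ i : Fin k, Integrable fun x => w x *
      fderiv ℝ (fun y => fderiv ℝ w y (EuclideanSpace.single i 1)) x (EuclideanSpace.single i 1) :=
    fun i => (hw.continuous.mul (continuous_partial (contDiff_partial hw _)
      _)).integrable_of_hasCompactSupport hwc.mul_right
  have e : ∀ x, -(w x * lap w x) = -∑ i, w x *
      fderiv ℝ (fun y => fderiv ℝ w y (EuclideanSpace.single i 1)) x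
        (EuclideanSpace.single i 1) := fun x => by rw [lap, Finset.mul_sum]
  simp_rw [e, gradSq]
  rw [integral_neg, integral_finsetSum _ fun i _ => hI1 i, integral_finsetSum _ fun i _ => hI2 i,
    ← Finset.sum_neg_distrib]
  refine Finset.sum_congr rfl fun i _ => ?_
  rw [integral_mul_fderiv_eq_neg_fderiv_mul_of_integrable]
  · simp [pow_two]
  · simpa [pow_two] using hI1 i
  · exact hI2 i
  · exact (hw.continuous.mul (continuous_partial hw1 _)).integrable_of_hasCompactSupport
      hwc.mul_right
  · exact fun x _ => hw1.differentiable (by norm_num) x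
  · exact fun x _ => (contDiff_partial hw _).differentiable (by norm_num) x

lemma lap_congr {f g : ESp k → ℝ} {x : ESp k} (h : f =ᶠ[nhds x] g) : lap f x = lap g x := by
  refine Finset.sum_congr rfl fun i _ => ?_
  have : (fun y => fderiv ℝ f y (EuclideanSpace.single i 1)) =ᶠ[nhds x]
      fun y => fderiv ℝ g y (EuclideanSpace.single i 1) :=
    (h.fderiv (𝕜 := ℝ)).mono fun y hy => by simp only [hy]
  rw [this.fderiv_eq]

lemma lap_trunc_comp (η : ℝ) {u : ESp k → ℝ} {V : Set (ESp k)} (hV : IsOpen V)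
    (hu : ContDiffOn ℝ 2 u V) {x : ESp k} (hx : x ∈ V) :
    lap (fun y => trunc η (u y)) x =
      Real.smoothTransition ((u x - η) / η) * lap u x +
      deriv (fun t : ℝ => Real.smoothTransition ((t - η) / η)) (u x) * gradSq u x := by
  rw [lap, lap, gradSq, Finset.mul_sum, Finset.mul_sum, ← Finset.sum_add_distrib]
  refine Finset.sum_congr rfl fun i _ => ?_
  set e : ESp k := EuclideanSpace.single i 1
  have hdiff : ∀ y ∈ V, DifferentiableAt ℝ u y := fun y hy =>
    (hu.contDiffAt (hV.mem_nhds hy)).differentiableAt (by norm_num)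
  have h1 : (fun y => fderiv ℝ (fun y => trunc η (u y)) y e) =ᶠ[nhds x]
      fun y => Real.smoothTransition ((u y - η) / η) * fderiv ℝ u y e := by
    filter_upwards [hV.mem_nhds hx] with y hy
    have := ((hasDerivAt_trunc η (u y)).comp_hasFDerivAt y (hdiff y hy).hasFDerivAt).fderiv
    simp only [Function.comp_def] at this
    rw [this]; simp
  rw [h1.fderiv_eq]
  have hS := ((contDiff_truncSlope η).differentiable (by norm_num) (u x)).hasDerivAt.comp_hasFDerivAt
    x (hdiff x hx).hasFDerivAt
  have hP : DifferentiableAt ℝ (fun y => fderiv ℝ u y e) x := by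
    have h2 : ContDiffAt ℝ 1 (fderiv ℝ u) x :=
      (hu.contDiffAt (hV.mem_nhds hx)).fderiv_right (by norm_num)
    exact (h2.differentiableAt (by norm_num)).clm_apply (differentiableAt_const _)
  have h3 := (hS.mul hP.hasFDerivAt).fderiv
  simp only [Function.comp_def] at h3
  have h4 : ((fun y => Real.smoothTransition ((u y - η) / η)) * fun y => fderiv ℝ u y e) =
      fun y => Real.smoothTransition ((u y - η) / η) * fderiv ℝ u y e := rfl
  rw [h4] at h3
  rw [h3]
  simp
  ring

/-- The truncation of `u` on `V`, extended by zero. -/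
def truncOn (V : Set (ESp k)) (η : ℝ) (u : ESp k → ℝ) : ESp k → ℝ :=
  V.indicator fun x => trunc η (u x)

section truncOn

variable {V : Set (ESp k)} {η : ℝ} {u : ESp k → ℝ}

lemma truncOn_nonneg (hη : 0 < η) (x : ESp k) : 0 ≤ truncOn V η u x :=
  indicator_nonneg (fun _ _ => trunc_nonneg hη _) x

lemma truncOn_of_mem {x : ESp k} (hx : x ∈ V) : truncOn V η u x = trunc η (u x) :=
  indicator_of_mem hx _

lemma truncOn_of_notMem {x : ESp k} (hx : x ∉ V) : truncOn V η u x = 0 :=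
  indicator_of_notMem hx _

lemma truncOn_isCompact (hV : IsOpen V) (hVb : Bornology.IsBounded V)
    (huc : ContinuousOn u (closure V)) (hfr : ∀ x ∈ frontier V, u x < η) :
    IsCompact (closure V ∩ u ⁻¹' Ici η) ∧ closure V ∩ u ⁻¹' Ici η ⊆ V := by
  refine ⟨?_, ?_⟩
  · exact hVb.isCompact_closure.of_isClosed_subset
      (huc.preimage_isClosed_of_isClosed isClosed_closure isClosed_Ici) inter_subset_left
  · rintro x ⟨hx, hxη⟩
    by_contra hxV
    have := hfr x ⟨hx, by rwa [hV.interior_eq]⟩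
    exact absurd (mem_Ici.1 hxη) (not_le.2 this)

lemma truncOn_eq_zero (hη : 0 < η) {x : ESp k} (hx : x ∉ closure V ∩ u ⁻¹' Ici η) :
    truncOn V η u x = 0 := by
  by_cases hxV : x ∈ V
  · rw [truncOn_of_mem hxV, trunc_eq_zero hη]
    by_contra h
    exact hx ⟨subset_closure hxV, (not_le.1 h).le⟩
  · exact truncOn_of_notMem hxV

lemma tsupport_truncOn (hη : 0 < η) (hV : IsOpen V) (hVb : Bornology.IsBounded V)
    (huc : ContinuousOn u (closure V)) (hfr : ∀ x ∈ frontier V, u x < η) :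
    tsupport (truncOn V η u) ⊆ V := by
  obtain ⟨h1, h2⟩ := truncOn_isCompact hV hVb huc hfr
  refine (closure_minimal ?_ h1.isClosed).trans h2
  intro x hx
  by_contra h
  exact hx (truncOn_eq_zero hη h)

lemma hasCompactSupport_truncOn (hη : 0 < η) (hV : IsOpen V) (hVb : Bornology.IsBounded V)
    (huc : ContinuousOn u (closure V)) (hfr : ∀ x ∈ frontier V, u x < η) :
    HasCompactSupport (truncOn V η u) :=
  HasCompactSupport.intro (truncOn_isCompact hV hVb huc hfr).1 fun _ hx => truncOn_eq_zero hη hx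

lemma truncOn_eventuallyEq (hV : IsOpen V) {x : ESp k} (hx : x ∈ V) :
    truncOn V η u =ᶠ[nhds x] fun y => trunc η (u y) := by
  filter_upwards [hV.mem_nhds hx] with y hy using truncOn_of_mem hy

lemma contDiff_truncOn (hη : 0 < η) (hV : IsOpen V) (hVb : Bornology.IsBounded V)
    (huc : ContinuousOn u (closure V)) (hu : ContDiffOn ℝ 2 u V)
    (hfr : ∀ x ∈ frontier V, u x < η) :
    ContDiff ℝ 2 (truncOn V η u) := by
  rw [contDiff_iff_contDiffAt]
  intro x
  by_cases hx : x ∈ V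
  · exact ((contDiff_trunc η).contDiffAt.comp x
      (hu.contDiffAt (hV.mem_nhds hx))).congr_of_eventuallyEq (truncOn_eventuallyEq hV hx)
  · have h := tsupport_truncOn hη hV hVb huc hfr
    have h2 : truncOn V η u =ᶠ[nhds x] fun _ => 0 := by
      filter_upwards [(isClosed_tsupport _).isOpen_compl.mem_nhds fun h' => hx (h h')] with y hy
      exact image_eq_zero_of_notMem_tsupport hy
    exact contDiffAt_const.congr_of_eventuallyEq h2

lemma le_lap_truncOn (hη : 0 < η) (hV : IsOpen V) (hVb : Bornology.IsBounded V)
    (huc : ContinuousOn u (closure V)) (hu : ContDiffOn ℝ 2 u V)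
    (hfr : ∀ x ∈ frontier V, u x < η) {μ : ℝ} (hμ : 0 ≤ μ) (hpos : ∀ x ∈ V, 0 ≤ u x)
    (hlap : ∀ x ∈ V, lap u x + μ * u x = 0) (x : ESp k) :
    -(μ * V.indicator u x) ≤ lap (truncOn V η u) x := by
  by_cases hx : x ∈ V
  · rw [lap_congr (truncOn_eventuallyEq hV hx), lap_trunc_comp η hV hu hx, indicator_of_mem hx]
    have h1 : lap u x = -(μ * u x) := by linarith [hlap x hx]
    have h2 := mul_nonneg (deriv_truncSlope_nonneg hη (u x)) (gradSq_nonneg u x)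
    have h3 := Real.smoothTransition.le_one ((u x - η) / η)
    have h4 := mul_nonneg hμ (hpos x hx)
    rw [h1]
    nlinarith
  · have h := tsupport_truncOn hη hV hVb huc hfr
    have h2 : truncOn V η u =ᶠ[nhds x] fun _ => 0 := by
      filter_upwards [(isClosed_tsupport _).isOpen_compl.mem_nhds fun h' => hx (h h')] with y hy
      exact image_eq_zero_of_notMem_tsupport hy
    rw [lap_congr h2, indicator_of_notMem hx]
    simp [lap]

/-- The truncated eigenfunction nearly satisfies the Rayleigh bound. -/
lemma integral_gradSq_truncOn_le (hη : 0 < η) (hV : IsOpen V) (hVb : Bornology.IsBounded V)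
    (huc : ContinuousOn u (closure V)) (hu : ContDiffOn ℝ 2 u V)
    (hfr : ∀ x ∈ frontier V, u x < η) {μ M : ℝ} (hμ : 0 ≤ μ) (hpos : ∀ x ∈ V, 0 ≤ u x)
    (hM : ∀ x ∈ V, u x ≤ M) (hlap : ∀ x ∈ V, lap u x + μ * u x = 0) :
    ∫ x, gradSq (truncOn V η u) x ≤
      μ * (∫ x, truncOn V η u x ^ 2) + 2 * η * μ * M * volume.real V := by
  have hC := contDiff_truncOn hη hV hVb huc hu hfr
  have hS := hasCompactSupport_truncOn hη hV hVb huc hfr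
  have hI1 : Integrable fun x => truncOn V η u x ^ 2 :=
    (hC.continuous.pow 2).integrable_of_hasCompactSupport
      (hasCompactSupport_sq hS)
  have hI2 : Integrable (V.indicator fun _ => 2 * η * μ * M) := by
    rw [integrable_indicator_iff hV.measurableSet]
    exact integrableOn_const (hVb.measure_lt_top).ne
  have hR : μ * (∫ x, truncOn V η u x ^ 2) + 2 * η * μ * M * volume.real V =
      ∫ x, μ * truncOn V η u x ^ 2 + V.indicator (fun _ => 2 * η * μ * M) x := by
    rw [integral_add (hI1.const_mul μ) hI2, integral_const_mul, integral_indicator hV.measurableSet]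
    simp
    ring
  rw [integral_gradSq hC hS, hR]
  refine integral_mono (hC.continuous.mul (continuous_lap hC)
    |>.integrable_of_hasCompactSupport hS.mul_right).neg ((hI1.const_mul μ).add hI2) fun x => ?_
  have h1 := le_lap_truncOn hη hV hVb huc hu hfr hμ hpos hlap x
  by_cases hx : x ∈ V
  · rw [indicator_of_mem hx] at h1
    have hw0 := truncOn_nonneg (V := V) (u := u) hη x
    have hw1 : truncOn V η u x ≤ u x := by rw [truncOn_of_mem hx]; exact trunc_le (hpos x hx)
    have hw2 : u x - 2 * η ≤ truncOn V η u x := by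
      rw [truncOn_of_mem hx]; exact sub_le_trunc hη _
    have hw3 := hw1.trans (hM x hx)
    simp only [indicator_of_mem hx]
    generalize truncOn V η u x = a at *
    have e1 : -(a * lap (truncOn V η u) x) ≤ μ * (a * u x) := by nlinarith
    have e2 : a * u x ≤ a ^ 2 + 2 * η * M := by nlinarith
    nlinarith
  · simp [truncOn_of_notMem hx, hx]

end truncOn

/-! ### Elementary properties of weighted averages -/

lemma integrable_mul_kerK {f : ESp k → ℝ} (hf : Continuous f) (x : ESp k) (r : ℝ) :
    Integrable fun z => f (x + r • z) * kerK z :=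
  ((hf.comp (by fun_prop)).mul continuous_kerK).integrable_of_hasCompactSupport
    hasCompactSupport_kerK.mul_left

lemma avg_sub {f g : ESp k → ℝ} (hf : Continuous f) (hg : Continuous g) (x : ESp k) (r : ℝ) :
    avg (fun y => f y - g y) x r = avg f x r - avg g x r := by
  simp only [avg, sub_mul]
  rw [integral_sub (integrable_mul_kerK hf x r) (integrable_mul_kerK hg x r), sub_div]

lemma avg_const_mul (f : ESp k → ℝ) (c : ℝ) (x : ESp k) (r : ℝ) :
    avg (fun y => c * f y) x r = c * avg f x r := by
  simp only [avg, mul_assoc]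
  rw [integral_const_mul, mul_div_assoc]

lemma add_smul_mem_closedBall {x z : ESp k} {r : ℝ} (hr : 0 ≤ r) (hz : kerK z ≠ 0) :
    x + r • z ∈ closedBall x r := by
  have := norm_lt_one_of_kerK_ne_zero hz
  simp only [mem_closedBall, dist_self_add_left, norm_smul, Real.norm_of_nonneg hr]
  nlinarith [norm_nonneg z]

lemma abs_avg_le {f : ESp k → ℝ} {x : ESp k} {r B : ℝ} (hr : 0 ≤ r)
    (h : ∀ y ∈ closedBall x r, |f y| ≤ B) : |avg f x r| ≤ B := by
  have hm := massK_pos (k := k)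
  rw [avg, abs_div, abs_of_pos hm, div_le_iff₀ hm, massK, ← integral_const_mul]
  rw [← Real.norm_eq_abs]
  refine norm_integral_le_of_norm_le (integrable_kerK.const_mul B) (Eventually.of_forall fun z => ?_)
  by_cases hz : kerK z = 0
  · simp [hz]
  · rw [norm_mul, Real.norm_of_nonneg (kerK_nonneg z), Real.norm_eq_abs]
    exact mul_le_mul_of_nonneg_right (h _ (add_smul_mem_closedBall hr hz)) (kerK_nonneg z)

lemma integral_affine (F : ESp k → ℝ) (x : ESp k) {r : ℝ} (hr : 0 < r) :
    ∫ z, F (x + r • z) = (r ^ k)⁻¹ * ∫ y, F y := by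
  rw [Measure.integral_comp_smul volume (fun z => F (x + z)) r,
    integral_add_left_eq_self (μ := volume) F x, smul_eq_mul, finrank_euclideanSpace,
    Fintype.card_fin, abs_of_pos (by positivity)]

lemma integrable_affine {F : ESp k → ℝ} (hF : Integrable F) (x : ESp k) {r : ℝ} (hr : 0 < r) :
    Integrable fun z => F (x + r • z) :=
  (hF.comp_add_left x).comp_smul hr.ne'

/-! ### The ground state substitution -/

section groundState

variable {U : Set (ESp k)} {g w : ESp k → ℝ} {μ : ℝ}

lemma contDiff_div (hU : IsOpen U) (hg : ContDiffOn ℝ 2 g U) (hgpos : ∀ x ∈ U, 0 < g x)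
    (hw : ContDiff ℝ 2 w) (hwU : tsupport w ⊆ U) : ContDiff ℝ 2 fun x => w x / g x := by
  rw [contDiff_iff_contDiffAt]
  intro x
  by_cases hx : x ∈ U
  · exact hw.contDiffAt.div (hg.contDiffAt (hU.mem_nhds hx)) (hgpos x hx).ne'
  · have h2 : (fun x => w x / g x) =ᶠ[nhds x] fun _ => 0 := by
      filter_upwards [(isClosed_tsupport w).isOpen_compl.mem_nhds fun h' => hx (hwU h')] with y hy
      rw [image_eq_zero_of_notMem_tsupport hy, zero_div]
    exact contDiffAt_const.congr_of_eventuallyEq h2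

lemma hasCompactSupport_div (hwc : HasCompactSupport w) :
    HasCompactSupport fun x => w x / g x :=
  HasCompactSupport.intro hwc.isCompact fun x hx => by
    rw [image_eq_zero_of_notMem_tsupport hx, zero_div]

lemma tsupport_div_subset : tsupport (fun x => w x / g x) ⊆ tsupport w :=
  closure_mono fun x hx h => hx (by simp [h])

/-- Ground state (Jacobi–Picone) identity. -/
lemma integral_groundState (hU : IsOpen U) (hg : ContDiffOn ℝ 2 g U) (hgpos : ∀ x ∈ U, 0 < g x)
    (hlap : ∀ x ∈ U, lap g x + μ * g x = 0)
    (hw : ContDiff ℝ 2 w) (hwc : HasCompactSupport w) (hwU : tsupport w ⊆ U) :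
    Integrable (fun x => g x ^ 2 * gradSq (fun y => w y / g y) x) ∧
    ∫ x, g x ^ 2 * gradSq (fun y => w y / g y) x = (∫ x, gradSq w x) - μ * ∫ x, w x ^ 2 := by
  set v : ESp k → ℝ := fun y => w y / g y with hv
  have hvC : ContDiff ℝ 2 v := contDiff_div hU hg hgpos hw hwU
  have hv1 : ContDiff ℝ 1 v := hvC.of_le (by norm_num)
  have hw1 : ContDiff ℝ 1 w := hw.of_le (by norm_num)
  set f : ESp k → ℝ := fun y => v y * w y with hf
  have hfC : ContDiff ℝ 2 f := hvC.mul hw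
  have hf1 : ContDiff ℝ 1 f := hfC.of_le (by norm_num)
  have hfc : HasCompactSupport f := hwc.mul_left
  have hfw : tsupport f ⊆ tsupport w := closure_mono fun x hx h => hx (by simp [hf, h])
  have hfU : tsupport f ⊆ U := hfw.trans hwU
  have hgd : ∀ x ∈ U, ContDiffAt ℝ 2 g x := fun x hx => hg.contDiffAt (hU.mem_nhds hx)
  have hgP : ∀ (e : ESp k) (x : ESp k), x ∈ U → ContDiffAt ℝ 1 (fun y => fderiv ℝ g y e) x :=
    fun e x hx => ((hgd x hx).fderiv_right (m := 1) (by norm_num)).clm_apply contDiffAt_const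
  have hgPc : ∀ e : ESp k, ContinuousOn (fun y => fderiv ℝ g y e) U := fun e x hx =>
    (hgP e x hx).continuousAt.continuousWithinAt
  have hgPPc : ∀ e : ESp k, ContinuousOn (fun x => fderiv ℝ (fun y => fderiv ℝ g y e) x e) U :=
    fun e x hx => (((hgP e x hx).fderiv_right (m := 0) (by norm_num)).clm_apply
      contDiffAt_const).continuousAt.continuousWithinAt
  have hInt : ∀ (a b : ESp k → ℝ), Continuous a → ContinuousOn b U → HasCompactSupport a →
      tsupport a ⊆ U → Integrable fun x => a x * b x := by
    intro a b ha hb hac haU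
    have h1 : tsupport (fun x => a x * b x) ⊆ tsupport a :=
      closure_mono fun x hx h => hx (by simp [h])
    exact ((ha.continuousOn.mul hb).continuous_of_tsupport_subset hU
      (h1.trans haU)).integrable_of_hasCompactSupport hac.mul_right
  have hfP : ∀ e : ESp k, tsupport (fun y => fderiv ℝ f y e) ⊆ U := fun e =>
    (tsupport_fderiv_apply_subset ℝ e).trans hfU
  have hIi : ∀ i : Fin k, Integrable fun x => fderiv ℝ f x (EuclideanSpace.single i 1) *
      fderiv ℝ g x (EuclideanSpace.single i 1) := fun i =>
    hInt _ _ (continuous_partial hf1 _) (hgPc _) (hfc.fderiv_apply (𝕜 := ℝ) _) (hfP _)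
  have hIf : ∀ i : Fin k, Integrable fun x => f x *
      fderiv ℝ (fun y => fderiv ℝ g y (EuclideanSpace.single i 1)) x (EuclideanSpace.single i 1) :=
    fun i => hInt _ _ hfC.continuous (hgPPc _) hfc hfU
  have hparts : ∀ i : Fin k, ∫ x, fderiv ℝ f x (EuclideanSpace.single i 1) *
      fderiv ℝ g x (EuclideanSpace.single i 1) = - ∫ x, f x *
      fderiv ℝ (fun y => fderiv ℝ g y (EuclideanSpace.single i 1)) x
        (EuclideanSpace.single i 1) := by
    intro i
    rw [integral_mul_fderiv_eq_neg_fderiv_mul_of_integrable (hIi i) (hIf i)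
      (hInt _ _ hfC.continuous (hgPc _) hfc hfU)
      (fun x _ => hf1.differentiable (by norm_num) x)
      (fun x hx => (hgP _ x (hfU hx)).differentiableAt (by norm_num)), neg_neg]
  have hsum : ∫ x, ∑ i, fderiv ℝ f x (EuclideanSpace.single i 1) *
      fderiv ℝ g x (EuclideanSpace.single i 1) = μ * ∫ x, w x ^ 2 := by
    rw [integral_finsetSum _ fun i _ => hIi i, Finset.sum_congr rfl fun i _ => hparts i,
      Finset.sum_neg_distrib, ← integral_finsetSum _ fun i _ => hIf i, ← integral_neg,
      ← integral_const_mul]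
    refine integral_congr_ae (Eventually.of_forall fun x => ?_)
    simp only
    rw [← Finset.mul_sum]
    by_cases hx : x ∈ U
    · have h1 := hlap x hx
      have h2 : f x * g x = w x ^ 2 := by
        have := (hgpos x hx).ne'
        simp only [hf, hv]; field_simp
      rw [lap] at h1
      rw [← h2, eq_neg_of_add_eq_zero_left h1]; ring
    · have : w x = 0 := image_eq_zero_of_notMem_tsupport fun h => hx (hwU h)
      simp [hf, this]
  have hpt : ∀ x, g x ^ 2 * gradSq v x = gradSq w x - ∑ i, fderiv ℝ f x (EuclideanSpace.single i 1) *
      fderiv ℝ g x (EuclideanSpace.single i 1) := by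
    intro x
    by_cases hx : x ∈ U
    · have hgx := (hgpos x hx).ne'
      rw [gradSq, gradSq, Finset.mul_sum, ← Finset.sum_sub_distrib]
      refine Finset.sum_congr rfl fun i _ => ?_
      have hvd := (hv1.differentiable (by norm_num) x).hasFDerivAt
      have hwd := (hw1.differentiable (by norm_num) x).hasFDerivAt
      have hgdx := ((hgd x hx).differentiableAt (by norm_num)).hasFDerivAt
      have e1 : fderiv ℝ f x = v x • fderiv ℝ w x + w x • fderiv ℝ v x := (hvd.mul hwd).fderiv
      have e2 : fderiv ℝ w x = v x • fderiv ℝ g x + g x • fderiv ℝ v x := by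
        rw [← (hvd.mul hgdx).fderiv]
        refine Filter.EventuallyEq.fderiv_eq ?_
        filter_upwards [hU.mem_nhds hx] with y hy
        have := (hgpos y hy).ne'
        simp only [hv, Pi.mul_apply]; field_simp
      have e3 : w x = v x * g x := by simp only [hv]; field_simp
      rw [e1, e2, e3]
      simp
      ring
    · have hw0 : x ∉ tsupport w := fun h => hx (hwU h)
      have hv0 : x ∉ tsupport v := fun h => hw0 (tsupport_div_subset h)
      have hf0 : ∀ i : Fin k, fderiv ℝ f x (EuclideanSpace.single i 1) = 0 := fun i =>
        image_eq_zero_of_notMem_tsupport (f := fun y => fderiv ℝ f y (EuclideanSpace.single i 1))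
          fun h => hx (hfP _ h)
      rw [gradSq_eq_zero_of_notMem hw0, gradSq_eq_zero_of_notMem hv0]
      simp [hf0]
  have hIs : Integrable fun x => ∑ i, fderiv ℝ f x (EuclideanSpace.single i 1) *
      fderiv ℝ g x (EuclideanSpace.single i 1) := integrable_finsetSum _ fun i _ => hIi i
  simp_rw [hpt]
  exact ⟨(integrable_gradSq hw1 hwc).sub hIs, by
    rw [integral_sub (integrable_gradSq hw1 hwc) hIs, hsum]⟩

/-- A positive solution on `U` bounds the Rayleigh quotient from below. -/
lemma mul_integral_sq_le (hU : IsOpen U) (hg : ContDiffOn ℝ 2 g U) (hgpos : ∀ x ∈ U, 0 < g x)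
    (hlap : ∀ x ∈ U, lap g x + μ * g x = 0)
    (hw : ContDiff ℝ 2 w) (hwc : HasCompactSupport w) (hwU : tsupport w ⊆ U) :
    μ * ∫ x, w x ^ 2 ≤ ∫ x, gradSq w x := by
  have h := (integral_groundState hU hg hgpos hlap hw hwc hwU).2
  have h2 : 0 ≤ ∫ x, g x ^ 2 * gradSq (fun y => w y / g y) x :=
    integral_nonneg fun x => mul_nonneg (sq_nonneg _) (gradSq_nonneg _ _)
  linarith

lemma abs_fderiv_apply_le (v : ESp k → ℝ) (x e : ESp k) {σ : ℝ} (hσ : 0 < σ) :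
    |fderiv ℝ v x e| ≤ ‖e‖ * (σ / 2 + gradSq v x / (2 * σ)) := by
  have h1 := (fderiv ℝ v x).le_opNorm e
  rw [Real.norm_eq_abs] at h1
  have h2 : ‖fderiv ℝ v x‖ ≤ σ / 2 + gradSq v x / (2 * σ) := by
    rw [← norm_fderiv_sq]
    have : σ / 2 + ‖fderiv ℝ v x‖ ^ 2 / (2 * σ) - ‖fderiv ℝ v x‖ =
      (σ - ‖fderiv ℝ v x‖) ^ 2 / (2 * σ) := by field_simp; ring
    have h3 : 0 ≤ (σ - ‖fderiv ℝ v x‖) ^ 2 / (2 * σ) := by positivity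
    linarith
  calc |fderiv ℝ v x e| ≤ ‖fderiv ℝ v x‖ * ‖e‖ := h1
    _ = ‖e‖ * ‖fderiv ℝ v x‖ := mul_comm _ _
    _ ≤ _ := mul_le_mul_of_nonneg_left h2 (norm_nonneg _)

/-- The averages of `w / g` vary little when the energy defect of `w` is small. -/
lemma abs_avg_div_sub_le (hU : IsOpen U) (hg : ContDiffOn ℝ 2 g U) (hgpos : ∀ x ∈ U, 0 < g x)
    (hlap : ∀ x ∈ U, lap g x + μ * g x = 0)
    (hw : ContDiff ℝ 2 w) (hwc : HasCompactSupport w) (hwU : tsupport w ⊆ U)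
    {p x : ESp k} {R r c₀ σ : ℝ} (hr : 0 < r) (hrR : r ≤ R) (hx : x ∈ ball p R)
    (hc₀ : 0 < c₀) (hgc : ∀ y ∈ closedBall p (2 * R), c₀ ≤ g y) (hσ : 0 < σ) :
    |avg (fun y => w y / g y) x r - avg (fun y => w y / g y) p r| ≤
      R * (σ / 2 + ((∫ y, gradSq w y) - μ * ∫ y, w y ^ 2) /
        (2 * σ * r ^ k * c₀ ^ 2 * massK k)) := by
  obtain ⟨hI, hD⟩ := integral_groundState hU hg hgpos hlap hw hwc hwU
  rw [← hD]
  set v : ESp k → ℝ := fun y => w y / g y with hv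
  have hv1 : ContDiff ℝ 1 v := (contDiff_div hU hg hgpos hw hwU).of_le (by norm_num)
  have hvc : HasCompactSupport v := hasCompactSupport_div hwc
  set D := ∫ y, g y ^ 2 * gradSq v y with hDdef
  have hD0 : 0 ≤ D := integral_nonneg fun x => mul_nonneg (sq_nonneg _) (gradSq_nonneg _ _)
  have hm := massK_pos (k := k)
  set e := x - p with he
  have hxR : ‖e‖ < R := by simpa [he, dist_eq_norm] using hx
  have hder := fun t : ℝ => hasDerivAt_integral_kerK hv1 hvc (fun z => p + r • z) (fun _ => e)
    (by fun_prop) continuous_const t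
  set B := σ / 2 * massK k + D / (2 * σ * r ^ k * c₀ ^ 2) with hB
  have hB0 : 0 ≤ B := by positivity
  have hbound : ∀ t ∈ Ico (0 : ℝ) 1, ‖∫ z, fderiv ℝ v (p + r • z + t • e) e * kerK z‖ ≤ R * B := by
    intro t ht
    have hIa := integrable_affine hI (p + t • e) hr
    have hpt : ∀ z, ‖fderiv ℝ v (p + r • z + t • e) e * kerK z‖ ≤
        R * (σ / 2 * kerK z + (g (p + t • e + r • z) ^ 2 * gradSq v (p + t • e + r • z)) *
          (2 * σ * c₀ ^ 2)⁻¹) := by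
      intro z
      have harg : p + r • z + t • e = p + t • e + r • z := by abel
      rw [harg]
      set y := p + t • e + r • z with hy
      have hG := gradSq_nonneg v y
      by_cases hz : kerK z = 0
      · rw [hz]; simp only [mul_zero, norm_zero, zero_add]
        have : 0 ≤ R := hr.le.trans hrR
        positivity
      · have hyb : y ∈ closedBall p (2 * R) := by
          have h1 := norm_lt_one_of_kerK_ne_zero hz
          rw [mem_closedBall, dist_eq_norm]
          have : y - p = t • e + r • z := by rw [hy]; abel
          rw [this]
          calc ‖t • e + r • z‖ ≤ ‖t • e‖ + ‖r • z‖ := norm_add_le _ _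
            _ = t * ‖e‖ + r * ‖z‖ := by
              rw [norm_smul, norm_smul, Real.norm_of_nonneg ht.1, Real.norm_of_nonneg hr.le]
            _ ≤ 2 * R := by nlinarith [ht.1, ht.2, norm_nonneg e, norm_nonneg z]
        have hgy := hgc y hyb
        rw [norm_mul, Real.norm_eq_abs, Real.norm_of_nonneg (kerK_nonneg z)]
        have h1 := abs_fderiv_apply_le v y e hσ
        have h2 : gradSq v y / (2 * σ) * kerK z ≤ g y ^ 2 * gradSq v y * (2 * σ * c₀ ^ 2)⁻¹ := by
          have h3 : gradSq v y * kerK z ≤ gradSq v y := mul_le_of_le_one_right hG (kerK_le_one z)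
          have h4 : c₀ ^ 2 * gradSq v y ≤ g y ^ 2 * gradSq v y := by gcongr
          calc gradSq v y / (2 * σ) * kerK z = gradSq v y * kerK z / (2 * σ) := by ring
            _ ≤ gradSq v y / (2 * σ) := by gcongr
            _ = c₀ ^ 2 * gradSq v y * (2 * σ * c₀ ^ 2)⁻¹ := by field_simp
            _ ≤ _ := by gcongr
        calc |fderiv ℝ v y e| * kerK z
            ≤ ‖e‖ * (σ / 2 + gradSq v y / (2 * σ)) * kerK z :=
              mul_le_mul_of_nonneg_right h1 (kerK_nonneg z)
          _ = ‖e‖ * (σ / 2 * kerK z + gradSq v y / (2 * σ) * kerK z) := by ring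
          _ ≤ R * (σ / 2 * kerK z + g y ^ 2 * gradSq v y * (2 * σ * c₀ ^ 2)⁻¹) := by
            have := kerK_nonneg z
            have hR0 : 0 ≤ R := hr.le.trans hrR
            gcongr
    refine (norm_integral_le_of_norm_le (((integrable_kerK.const_mul _).add
      (hIa.mul_const _)).const_mul R) (Eventually.of_forall hpt)).trans (le_of_eq ?_)
    rw [integral_const_mul]
    simp only [Pi.add_apply]
    rw [integral_add (integrable_kerK.const_mul _) (hIa.mul_const _), integral_const_mul,
      integral_mul_const, integral_affine (fun y => g y ^ 2 * gradSq v y) _ hr, hB, massK, hDdef]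
    congr 2
    field_simp
  have hmv := norm_image_sub_le_of_norm_deriv_le_segment_01'
    (f := fun t : ℝ => ∫ z, v (p + r • z + t • e) * kerK z)
    (fun t _ => (hder t).hasDerivWithinAt) hbound
  have h1 : ∀ z, p + r • z + (1 : ℝ) • e = x + r • z := fun z => by simp [he]; abel
  have h0 : ∀ z, p + r • z + (0 : ℝ) • e = p + r • z := fun z => by simp
  simp only [h1, h0] at hmv
  rw [avg, avg, ← sub_div, abs_div, abs_of_pos hm, div_le_iff₀ hm, ← Real.norm_eq_abs]
  refine hmv.trans (le_of_eq ?_)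
  rw [hB]
  field_simp

/-- If the energy defect of `w` relative to the positive solution `g` is small, and `f` is close
to `w` and nearly equal to its averages, then `f / g` is locally nearly constant. -/
lemma local_quotient (hU : IsOpen U) (hg : ContDiffOn ℝ 2 g U) (hgpos : ∀ x ∈ U, 0 < g x)
    (hlap : ∀ x ∈ U, lap g x + μ * g x = 0) {p : ESp k} (hp : p ∈ U) :
    ∃ R > 0, closedBall p (2 * R) ⊆ U ∧ ∀ s > 0, ∃ s' > 0, ∃ r₀ > 0, r₀ ≤ R ∧
      ∀ r, 0 < r → r ≤ r₀ → ∃ η > 0, ∀ f w : ESp k → ℝ, Continuous f →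
        ContDiff ℝ 2 w → HasCompactSupport w → tsupport w ⊆ U →
        ((∫ y, gradSq w y) - μ * ∫ y, w y ^ 2) ≤ η →
        (∀ y ∈ closedBall p (2 * R), |f y - w y| ≤ η ∧ |w y| ≤ 1) →
        (∀ x ∈ ball p R, |f x - avg f x r| ≤ s') →
        ∀ x ∈ ball p R, |f x / g x - f p / g p| ≤ s := by
  obtain ⟨R', hR', hRU'⟩ := nhds_basis_closedBall.mem_iff.1 (hU.mem_nhds hp)
  set R := R' / 2 with hRdef
  have hR : 0 < R := by positivity
  have hRU : closedBall p (2 * R) ⊆ U := by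
    have : 2 * R = R' := by rw [hRdef]; ring
    rwa [this]
  have hgc : ContinuousOn g (closedBall p (2 * R)) := (hg.continuousOn).mono hRU
  obtain ⟨q, hq, hqmin⟩ := (isCompact_closedBall p (2 * R)).exists_isMinOn
    ⟨p, mem_closedBall_self (by positivity)⟩ hgc
  set c₀ := g q with hc
  have hc₀ : 0 < c₀ := hgpos q (hRU hq)
  have hgc₀ : ∀ y ∈ closedBall p (2 * R), c₀ ≤ g y := fun y hy => hqmin hy
  have hm := massK_pos (k := k)
  refine ⟨R, hR, hRU, fun s hs => ?_⟩
  have hs1 : 0 < s * c₀ ^ 2 / 12 := by positivity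
  obtain ⟨r₁, hr₁, hosc⟩ := Metric.uniformContinuousOn_iff_le.1
    ((isCompact_closedBall p (2 * R)).uniformContinuousOn_of_continuous hgc) _ hs1
  refine ⟨s * c₀ / 12, by positivity, min r₁ R, lt_min hr₁ hR, min_le_right _ _, ?_⟩
  intro r hr hrr
  set σ := s / (2 * R) with hσ
  have hσ0 : 0 < σ := by positivity
  have hη2 : 0 < s * σ * r ^ k * c₀ ^ 2 * massK k / (2 * R) := by positivity
  refine ⟨min (s * c₀ / 12) (s * σ * r ^ k * c₀ ^ 2 * massK k / (2 * R)),
    lt_min (by positivity) hη2, ?_⟩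
  intro f w hf hw hwc hwU hD hfw hmean x hx
  have hrR : r ≤ R := hrr.trans (min_le_right _ _)
  have hvc : Continuous fun y => w y / g y := (contDiff_div hU hg hgpos hw hwU).continuous
  have hstep : ∀ x ∈ ball p R, |f x / g x - avg (fun y => w y / g y) x r| ≤ s / 4 := by
    intro x hx
    have hsub : closedBall x r ⊆ closedBall p (2 * R) :=
      closedBall_subset_closedBall' (by linarith [mem_ball.1 hx])
    have hxp : x ∈ closedBall p (2 * R) := hsub (mem_closedBall_self hr.le)
    have hgx := hgc₀ x hxp
    have hgx0 : 0 < g x := hc₀.trans_le hgx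
    have h1 : |avg (fun y => f y - g x * (w y / g y)) x r| ≤ s * c₀ / 6 := by
      refine abs_avg_le hr.le fun y hy => ?_
      have hyp := hsub hy
      have hgy := hgc₀ y hyp
      have hgy0 : 0 < g y := hc₀.trans_le hgy
      have e1 : f y - g x * (w y / g y) = (f y - w y) + (w y) * ((g y - g x) / g y) := by
        field_simp; ring
      have e2 : |(g y - g x) / g y| ≤ s * c₀ / 12 := by
        rw [abs_div, abs_of_pos hgy0, div_le_iff₀ hgy0]
        have := hosc y hyp x hxp ((mem_closedBall.1 hy).trans (hrr.trans (min_le_left _ _)))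
        rw [Real.dist_eq] at this
        calc |g y - g x| ≤ s * c₀ ^ 2 / 12 := this
          _ = s * c₀ / 12 * c₀ := by ring
          _ ≤ _ := by gcongr
      rw [e1]
      calc |(f y - w y) + (w y) * ((g y - g x) / g y)|
          ≤ |f y - w y| + |w y| * |(g y - g x) / g y| := by
            rw [← abs_mul]; exact abs_add_le _ _
        _ ≤ s * c₀ / 12 + 1 * (s * c₀ / 12) := by
            have h2 := (hfw y hyp)
            have h3 := h2.1.trans (min_le_left _ _)
            have h4 := h2.2
            gcongr
        _ = s * c₀ / 6 := by ring
    rw [avg_sub (g := fun y => g x * (w y / g y)) hf (continuous_const.mul hvc),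
      avg_const_mul] at h1
    have h2 := hmean x hx
    have h3 : |f x - g x * avg (fun y => w y / g y) x r| ≤ s * c₀ / 4 := by
      rw [abs_le] at h1 h2 ⊢
      constructor <;> linarith [h1.1, h1.2, h2.1, h2.2]
    have e3 : f x / g x - avg (fun y => w y / g y) x r =
        (f x - g x * avg (fun y => w y / g y) x r) / g x := by field_simp
    rw [e3, abs_div, abs_of_pos hgx0, div_le_iff₀ hgx0]
    refine h3.trans ?_
    nlinarith
  have hA := hstep x hx
  have hB := hstep p (mem_ball_self hR)
  have hC := abs_avg_div_sub_le hU hg hgpos hlap hw hwc hwU hr hrR hx hc₀ hgc₀ hσ0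
  have hC' : R * (σ / 2 + ((∫ y, gradSq w y) - μ * ∫ y, w y ^ 2) /
        (2 * σ * r ^ k * c₀ ^ 2 * massK k)) ≤ s / 2 := by
    have h5 : ((∫ y, gradSq w y) - μ * ∫ y, w y ^ 2) / (2 * σ * r ^ k * c₀ ^ 2 * massK k) ≤
        s / (4 * R) := by
      rw [div_le_iff₀ (by positivity)]
      refine (hD.trans (min_le_right _ _)).trans (le_of_eq ?_)
      field_simp
      ring
    calc _ ≤ R * (σ / 2 + s / (4 * R)) := by gcongr
      _ = s / 2 := by rw [hσ]; field_simp; ring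
  rw [abs_le] at hA hB hC ⊢
  constructor <;> linarith [hA.1, hA.2, hB.1, hB.2, hC.1, hC.2]

end groundState

/-! ### Solutions normalized to have maximum one -/

lemma avg_mono {f g : ESp k → ℝ} (hf : Continuous f) (hg : Continuous g) (h : ∀ y, f y ≤ g y)
    (x : ESp k) (r : ℝ) : avg f x r ≤ avg g x r :=
  div_le_div_of_nonneg_right (integral_mono (integrable_mul_kerK hf x r)
    (integrable_mul_kerK hg x r) fun z => mul_le_mul_of_nonneg_right (h _) (kerK_nonneg z))
    massK_pos.le

lemma avg_congr {f g : ESp k → ℝ} {x : ESp k} {r : ℝ} (hr : 0 ≤ r)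
    (h : ∀ y ∈ closedBall x r, f y = g y) : avg f x r = avg g x r := by
  rw [avg, avg]
  congr 1
  refine integral_congr_ae (Eventually.of_forall fun z => ?_)
  by_cases hz : kerK z = 0
  · simp [hz]
  · simp only
    rw [h _ (add_smul_mem_closedBall hr hz)]

lemma avg_neg (f : ESp k → ℝ) (x : ESp k) (r : ℝ) :
    avg (fun y => -f y) x r = -avg f x r := by
  simpa using avg_const_mul f (-1) x r

lemma lap_neg (f : ESp k → ℝ) (x : ESp k) : lap (fun y => -f y) x = -lap f x := by
  simp [lap, fderiv_fun_neg]

lemma lap_const_mul {f : ESp k → ℝ} {V : Set (ESp k)} (hV : IsOpen V) (hf : ContDiffOn ℝ 2 f V)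
    (c : ℝ) {x : ESp k} (hx : x ∈ V) : lap (fun y => c * f y) x = c * lap f x := by
  rw [lap, lap, Finset.mul_sum]
  refine Finset.sum_congr rfl fun i _ => ?_
  have hd : ∀ y ∈ V, ContDiffAt ℝ 2 f y := fun y hy => hf.contDiffAt (hV.mem_nhds hy)
  have h1 : (fun y => fderiv ℝ (fun y => c * f y) y (EuclideanSpace.single i 1)) =ᶠ[nhds x]
      fun y => c * fderiv ℝ f y (EuclideanSpace.single i 1) := by
    filter_upwards [hV.mem_nhds hx] with y hy
    rw [fderiv_const_mul ((hd y hy).differentiableAt (by norm_num))]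
    simp
  have h2 : DifferentiableAt ℝ (fun y => fderiv ℝ f y (EuclideanSpace.single i 1)) x :=
    (((hd x hx).fderiv_right (m := 1) (by norm_num)).clm_apply
      contDiffAt_const).differentiableAt (by norm_num)
  rw [h1.fderiv_eq, fderiv_const_mul h2]
  simp

lemma dirEig1_nonneg (U : Set (ESp k)) : 0 ≤ dirEig1 U := by
  refine Real.sInf_nonneg ?_
  rintro r ⟨u, -, -, -, -, rfl⟩
  exact div_nonneg (integral_nonneg fun x => by positivity) (integral_nonneg fun x => by positivity)

/-- `u` is a positive solution of `Δu + μu = 0` on the bounded open set `V`, continuously extended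
by zero and bounded by `1`. -/
structure UnitSolution (V : Set (ESp k)) (μ : ℝ) (u : ESp k → ℝ) : Prop where
  isOpen : IsOpen V
  isBounded : Bornology.IsBounded V
  continuous : Continuous u
  contDiffOn : ContDiffOn ℝ 2 u V
  lap_eq : ∀ x ∈ V, lap u x + μ * u x = 0
  zero : ∀ x ∉ V, u x = 0
  pos : ∀ x ∈ V, 0 < u x
  le_one : ∀ x, u x ≤ 1
  eig_nonneg : 0 ≤ μ

namespace UnitSolution

variable {V : Set (ESp k)} {μ : ℝ} {u : ESp k → ℝ}

lemma nonneg (h : UnitSolution V μ u) (x : ESp k) : 0 ≤ u x := by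
  by_cases hx : x ∈ V
  · exact (h.pos x hx).le
  · exact (h.zero x hx).ge

lemma abs_le_one (h : UnitSolution V μ u) (x : ESp k) : |u x| ≤ 1 := by
  rw [abs_of_nonneg (h.nonneg x)]; exact h.le_one x

lemma frontier_eq_zero (h : UnitSolution V μ u) : ∀ x ∈ frontier V, u x = 0 := fun x hx =>
  h.zero x fun hxV => by
    rw [h.isOpen.frontier_eq] at hx
    exact hx.2 hxV

lemma hasCompactSupport (h : UnitSolution V μ u) : HasCompactSupport u :=
  HasCompactSupport.intro h.isBounded.isCompact_closure fun x hx =>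
    h.zero x fun h' => hx (subset_closure h')

lemma integrable (h : UnitSolution V μ u) : Integrable u :=
  h.continuous.integrable_of_hasCompactSupport h.hasCompactSupport

/-- Truncating a solution on a subdomain gives a test function with almost the same energy. -/
lemma truncOn_spec (h : UnitSolution V μ u) {W : Set (ESp k)} (hW : IsOpen W) (hWV : W ⊆ V) {η : ℝ}
    (hη : 0 < η) (hfr : ∀ x ∈ frontier W, u x < η) :
    ContDiff ℝ 2 (truncOn W η u) ∧ HasCompactSupport (truncOn W η u) ∧
    tsupport (truncOn W η u) ⊆ W ∧ (∀ x, |truncOn W η u x| ≤ 1) ∧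
    (∀ x ∈ W, |u x - truncOn W η u x| ≤ 2 * η) ∧
    ∫ x, gradSq (truncOn W η u) x ≤
      (μ * ∫ x, truncOn W η u x ^ 2) + 2 * η * μ * volume.real W := by
  have hb : Bornology.IsBounded W := h.isBounded.subset hWV
  have hc : ContinuousOn u (closure W) := h.continuous.continuousOn
  have hC : ContDiffOn ℝ 2 u W := h.contDiffOn.mono hWV
  refine ⟨contDiff_truncOn hη hW hb hc hC hfr, hasCompactSupport_truncOn hη hW hb hc hfr,
    tsupport_truncOn hη hW hb hc hfr, fun x => ?_, fun x hx => ?_, ?_⟩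
  · rw [abs_of_nonneg (truncOn_nonneg hη x)]
    by_cases hx : x ∈ W
    · rw [truncOn_of_mem hx]
      exact (trunc_le (h.nonneg x)).trans (h.le_one x)
    · rw [truncOn_of_notMem hx]; exact zero_le_one
  · rw [truncOn_of_mem hx, abs_le]
    have h1 := sub_le_trunc hη (u x)
    have h2 := trunc_le (η := η) (h.nonneg x)
    constructor <;> linarith
  · have := integral_gradSq_truncOn_le hη hW hb hc hC hfr h.eig_nonneg (fun x _ => h.nonneg x)
      (fun x _ => h.le_one x) fun x hx => h.lap_eq x (hWV hx)
    simpa using this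

/-- Sub-mean value property. -/
lemma le_avg (h : UnitSolution V μ u) {A : ℝ} (hA : μ ≤ A) (x : ESp k) {r : ℝ} (hr : 0 ≤ r) :
    u x ≤ avg u x r + A * meanC k * r ^ 2 := by
  refine le_of_forall_pos_le_add fun η hη => ?_
  have hη2 : 0 < η / 2 := by positivity
  have hfr : ∀ x ∈ frontier V, u x < η / 2 := fun x hx => by rw [h.frontier_eq_zero x hx]; exact hη2
  obtain ⟨hC, hcs, hts, -, hclose, -⟩ := h.truncOn_spec h.isOpen Subset.rfl hη2 hfr
  have hle : ∀ y, truncOn V (η / 2) u y ≤ u y := fun y => by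
    by_cases hy : y ∈ V
    · rw [truncOn_of_mem hy]; exact trunc_le (h.nonneg y)
    · rw [truncOn_of_notMem hy]; exact h.nonneg y
  have hux : u x ≤ truncOn V (η / 2) u x + η := by
    by_cases hx : x ∈ V
    · have := (abs_le.1 (hclose x hx)).2
      linarith
    · rw [h.zero x hx]; linarith [truncOn_nonneg (V := V) (u := u) hη2 x]
  have hlap : ∀ y ∈ closedBall x r, -A ≤ lap (truncOn V (η / 2) u) y := fun y _ => by
    refine le_trans ?_ (le_lap_truncOn hη2 h.isOpen h.isBounded h.continuous.continuousOn
      h.contDiffOn hfr h.eig_nonneg (fun x _ => h.nonneg x) h.lap_eq y)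
    have h1 : V.indicator u y ≤ 1 := (indicator_le_self' (fun x _ => h.nonneg x) y).trans (h.le_one y)
    nlinarith [h.eig_nonneg]
  have h1 := le_avg_add hC hcs hr (h.eig_nonneg.trans hA) hlap
  have h2 := avg_mono hC.continuous h.continuous hle x r
  linarith

/-- Approximate mean value property in the interior. -/
lemma abs_sub_avg_le (h : UnitSolution V μ u) {A : ℝ} (hA : μ ≤ A) {x : ESp k} {r r' : ℝ}
    (hr : 0 < r) (hrr' : r < r') (hsub : closedBall x r' ⊆ V) :
    |u x - avg u x r| ≤ A * meanC k * r ^ 2 := by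
  have hA0 : 0 ≤ A * meanC k * r ^ 2 :=
    mul_nonneg (mul_nonneg (h.eig_nonneg.trans hA) (meanC_nonneg)) (sq_nonneg r)
  let χ : ContDiffBump x := ⟨(r + r') / 2, r', by linarith, by linarith⟩
  set w : ESp k → ℝ := fun y => χ y * u y with hw
  have hts : tsupport χ ⊆ V := by rw [χ.tsupport_eq]; exact hsub
  have hwC : ContDiff ℝ 2 w := by
    rw [contDiff_iff_contDiffAt]
    intro y
    by_cases hy : y ∈ V
    · exact χ.contDiff.contDiffAt.mul (h.contDiffOn.contDiffAt (h.isOpen.mem_nhds hy))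
    · have h2 : w =ᶠ[nhds y] fun _ => 0 := by
        filter_upwards [(isClosed_tsupport χ).isOpen_compl.mem_nhds fun h' => hy (hts h')] with z hz
        simp only [hw]
        rw [image_eq_zero_of_notMem_tsupport hz, zero_mul]
      exact contDiffAt_const.congr_of_eventuallyEq h2
  have hwc : HasCompactSupport w := χ.hasCompactSupport.mul_right
  have hball : ∀ y ∈ ball x ((r + r') / 2), w y = u y := fun y hy => by
    simp only [hw]
    rw [χ.one_of_mem_closedBall (ball_subset_closedBall hy), one_mul]
  have hin : closedBall x r ⊆ ball x ((r + r') / 2) := closedBall_subset_ball (by linarith)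
  have hlap : ∀ y ∈ closedBall x r, -0 ≤ lap (fun y => -w y) y := fun y hy => by
    have hyV : y ∈ V := hsub (closedBall_subset_closedBall hrr'.le hy)
    have he : w =ᶠ[nhds y] u := by
      filter_upwards [isOpen_ball.mem_nhds (hin hy)] with z hz using hball z hz
    rw [lap_neg, lap_congr he]
    nlinarith [h.lap_eq y hyV, mul_nonneg h.eig_nonneg (h.nonneg y)]
  have h1 := le_avg_add hwC.neg hwc.neg hr.le le_rfl hlap
  have h2 := h.le_avg hA x hr.le
  rw [avg_neg,
    avg_congr hr.le fun y hy => hball y (hin hy),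
    hball x (mem_ball_self (by linarith))] at h1
  rw [abs_le]
  constructor <;> linarith

end UnitSolution

/-- A positive first eigenfunction, normalised to have supremum one. -/
lemma IsFirstDirEigenfun.unitSolution {U : Set (ESp k)} {φ : ESp k → ℝ}
    (hφ : IsFirstDirEigenfun U φ) (hb : Bornology.IsBounded U) (hpos : ∀ x ∈ U, 0 < φ x) :
    ∃ M > 0, M = sSup (φ '' U) ∧ UnitSolution U (dirEig1 U) (U.indicator fun x => M⁻¹ * φ x) := by
  obtain ⟨⟨a, ha, -⟩, hC, hc, hlap, hfr⟩ := hφ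
  have hbdd : BddAbove (φ '' U) :=
    ((hb.isCompact_closure.image_of_continuousOn hc).bddAbove).mono (image_mono subset_closure)
  have hle : ∀ x ∈ U, φ x ≤ sSup (φ '' U) := fun x hx => le_csSup hbdd (mem_image_of_mem _ hx)
  have hM : 0 < sSup (φ '' U) := (hpos a ha).trans_le (hle a ha)
  set M := sSup (φ '' U) with hMdef
  have hopen : IsOpen U := by
    rw [← disjoint_frontier_iff_isOpen, Set.disjoint_left]
    exact fun x hx hxU => (hpos x hxU).ne' (hfr x hx)
  have hon : ∀ x ∈ U, U.indicator (fun x => M⁻¹ * φ x) x = M⁻¹ * φ x := fun x hx =>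
    indicator_of_mem hx _
  refine ⟨M, hM, rfl, hopen, hb, ?_, ?_, ?_, fun x hx => indicator_of_notMem hx _, ?_, ?_,
    dirEig1_nonneg U⟩
  · exact continuous_indicator (fun x hx => by rw [hfr x hx, mul_zero]) (continuousOn_const.mul hc)
  · exact (contDiffOn_const.mul hC).congr hon
  · intro x hx
    have he : U.indicator (fun x => M⁻¹ * φ x) =ᶠ[nhds x] fun x => M⁻¹ * φ x := by
      filter_upwards [hopen.mem_nhds hx] with y hy using hon y hy
    rw [lap_congr he, lap_const_mul hopen hC _ hx, hon x hx]
    linear_combination M⁻¹ * hlap x hx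
  · intro x hx
    rw [hon x hx]
    exact mul_pos (inv_pos.2 hM) (hpos x hx)
  · intro x
    by_cases hx : x ∈ U
    · rw [hon x hx, inv_mul_le_iff₀ hM, mul_one]; exact hle x hx
    · rw [indicator_of_notMem hx]; exact zero_le_one

lemma abs_sub_avg_le_of_dist {f : ESp k → ℝ} (hf : Continuous f) {x : ESp k} {r s : ℝ} (hr : 0 ≤ r)
    (h : ∀ y ∈ closedBall x r, |f x - f y| ≤ s) : |f x - avg f x r| ≤ s := by
  have h1 : avg (fun _ => f x) x r = f x := by
    rw [avg, integral_const_mul, ← massK, mul_div_assoc, div_self massK_pos.ne', mul_one]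
  have h2 := avg_sub (f := fun _ => f x) continuous_const hf x r
  rw [h1] at h2
  rw [← h2]
  exact abs_avg_le hr h

lemma exists_pos_mul_le {s : ℝ} (hs : 0 < s) (a : ℝ) : ∃ η > 0, η * a ≤ s ∧ η ≤ s := by
  refine ⟨s / (|a| + 1), by positivity, ?_, ?_⟩
  · rw [div_mul_eq_mul_div, div_le_iff₀ (by positivity)]
    nlinarith [le_abs_self a]
  · rw [div_le_iff₀ (by positivity)]
    nlinarith [abs_nonneg a]

namespace UnitSolution

variable {U V : Set (ESp k)} {lam μ : ℝ} {g u : ESp k → ℝ}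

/-- Strict monotonicity of the eigenvalue under domain enlargement. -/
lemma eig_lt (hg : UnitSolution U lam g) (hu : UnitSolution V μ u) (hUV : U ⊆ V) {p : ESp k}
    (hpV : p ∈ V) (hp : p ∈ frontier U) : μ < lam := by
  by_contra! hle
  obtain ⟨R, hR, hRV, H⟩ := local_quotient hu.isOpen hu.contDiffOn hu.pos hu.lap_eq hpV
  have hgp : g p = 0 := hg.frontier_eq_zero p hp
  have key : ∀ s > 0, ∀ x ∈ ball p R, |g x / u x| ≤ s := by
    intro s hs
    obtain ⟨s', hs', r₀, hr₀, hr₀R, H⟩ := H s hs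
    have huc : UniformContinuous g := hg.continuous.uniformContinuous_of_tendsto_cocompact
      (x := 0) hg.hasCompactSupport.is_zero_at_infty
    obtain ⟨r₁, hr₁, hr⟩ := Metric.uniformContinuous_iff_le.1 huc s' hs'
    obtain ⟨η', hη', H⟩ := H (min r₀ r₁) (lt_min hr₀ hr₁) (min_le_left _ _)
    obtain ⟨η, hη, hη1, hη2⟩ := exists_pos_mul_le (half_pos hη') (lam * volume.real U)
    have hfr : ∀ x ∈ frontier U, g x < η := fun x hx => by rw [hg.frontier_eq_zero x hx]; exact hη
    obtain ⟨hC, hcs, hts, habs, hclose, hen⟩ := hg.truncOn_spec hg.isOpen Subset.rfl hη hfr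
    have hw0 : 0 ≤ ∫ x, truncOn U η g x ^ 2 := integral_nonneg fun x => sq_nonneg _
    have := H g (truncOn U η g) hg.continuous hC hcs (hts.trans hUV) (by nlinarith)
      (fun y _ => ⟨?_, habs y⟩) (fun x _ => ?_)
    · intro x hx
      simpa [hgp] using this x hx
    · by_cases hy : y ∈ U
      · exact (hclose y hy).trans (by linarith)
      · rw [hg.zero y hy, truncOn_of_notMem hy]; simpa using hη'.le
    · refine abs_sub_avg_le_of_dist hg.continuous (lt_min hr₀ hr₁).le fun y hy => ?_
      rw [← Real.dist_eq]
      refine hr ?_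
      rw [dist_comm]
      exact (mem_closedBall.1 hy).trans (min_le_right _ _)
  obtain ⟨x, hxR, hxU⟩ := mem_closure_iff_nhds.1 (frontier_subset_closure hp) _ (ball_mem_nhds p hR)
  have hq : 0 < g x / u x := div_pos (hg.pos x hxU) (hu.pos x (hUV hxU))
  have := key (g x / u x / 2) (half_pos hq) x hxR
  rw [abs_of_pos hq] at this
  linarith

/-- Solutions on larger domains which are small on the boundary of `U` have locally nearly constant
quotient with the positive solution on `U`. -/
lemma quotient_close (hg : UnitSolution U lam g) {p : ESp k} (hp : p ∈ U) :
    ∃ R > 0, ball p R ⊆ U ∧ ∀ s > 0, ∃ η > 0, ∀ (V : Set (ESp k)) (μ : ℝ) (u : ESp k → ℝ),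
      UnitSolution V μ u → U ⊆ V → μ ≤ lam → (∀ x ∈ frontier U, u x < η) →
      ∀ x ∈ ball p R, |u x / g x - u p / g p| ≤ s := by
  obtain ⟨R, hR, hRU, H⟩ := local_quotient hg.isOpen hg.contDiffOn hg.pos hg.lap_eq hp
  refine ⟨R, hR, (ball_subset_closedBall.trans (closedBall_subset_closedBall (by linarith))).trans
    hRU, fun s hs => ?_⟩
  obtain ⟨s', hs', r₀, hr₀, hr₀R, H⟩ := H s hs
  obtain ⟨r₁, hr₁, hr₁A, -⟩ := exists_pos_mul_le hs' (lam * meanC k)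
  set r := min (r₀ / 2) (min r₁ 1) with hr
  have hr0 : 0 < r := lt_min (by positivity) (lt_min hr₁ one_pos)
  have hrr₀ : r ≤ r₀ / 2 := min_le_left _ _
  have hrr₁ : r ≤ r₁ := (min_le_right _ _).trans (min_le_left _ _)
  have hr1 : r ≤ 1 := (min_le_right _ _).trans (min_le_right _ _)
  obtain ⟨η', hη', H⟩ := H r hr0 (by linarith)
  obtain ⟨η, hη, hη1, hη2⟩ := exists_pos_mul_le (half_pos hη') (lam * volume.real U)
  refine ⟨η, hη, fun V μ u hu hUV hμ hfr => ?_⟩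
  obtain ⟨hC, hcs, hts, habs, hclose, hen⟩ := hu.truncOn_spec hg.isOpen hUV hη hfr
  have hw0 : 0 ≤ ∫ x, truncOn U η u x ^ 2 := integral_nonneg fun x => sq_nonneg _
  have hvol : 0 ≤ volume.real U := measureReal_nonneg
  refine H u (truncOn U η u) hu.continuous hC hcs hts ?_
    (fun y hy => ⟨(hclose y (hRU hy)).trans (by linarith), habs y⟩) fun x hx => ?_
  · have h1 : μ * (∫ x, truncOn U η u x ^ 2) ≤ lam * ∫ x, truncOn U η u x ^ 2 := by gcongr
    have h2 : 2 * η * μ * volume.real U ≤ 2 * η * lam * volume.real U := by gcongr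
    linarith
  · refine (hu.abs_sub_avg_le hμ hr0 (show r < R by linarith) ?_).trans ?_
    · exact (closedBall_subset_closedBall' (by linarith [mem_ball.1 hx])).trans (hRU.trans hUV)
    · have h0 : 0 ≤ lam * meanC k := mul_nonneg hg.eig_nonneg meanC_nonneg
      calc lam * meanC k * r ^ 2 ≤ lam * meanC k * r₁ := by
            gcongr
            nlinarith
        _ ≤ s' := by linarith

/-- If the Rayleigh quotient on `U` is bounded below by a number above `lam`, solutions with
eigenvalue at most `lam` which are small on the boundary of `U` have small integral on `U`. -/
lemma setIntegral_le (hU : IsOpen U) (hb : Bornology.IsBounded U) {lam₂ : ℝ} (hlam : lam < lam₂)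
    (hray : ∀ w : ESp k → ℝ, ContDiff ℝ 2 w → HasCompactSupport w → tsupport w ⊆ U →
      lam₂ * ∫ x, w x ^ 2 ≤ ∫ x, gradSq w x) {s : ℝ} (hs : 0 < s) :
    ∃ η > 0, ∀ (V : Set (ESp k)) (μ : ℝ) (u : ESp k → ℝ),
      UnitSolution V μ u → U ⊆ V → μ ≤ lam → (∀ x ∈ frontier U, u x < η) →
      ∫ x in U, u x ≤ s := by
  have hvol : 0 ≤ volume.real U := measureReal_nonneg
  have hgap : 0 < lam₂ - lam := by linarith
  obtain ⟨σ, hσ, hσ1, -⟩ := exists_pos_mul_le (half_pos hs) (volume.real U)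
  obtain ⟨η, hη, hη1, -⟩ := exists_pos_mul_le (half_pos hs)
    (2 * volume.real U + 2 * lam * volume.real U / (lam₂ - lam) / (4 * σ))
  refine ⟨η, hη, fun V μ u hu hUV hμ hfr => ?_⟩
  obtain ⟨hC, hcs, hts, habs, hclose, hen⟩ := hu.truncOn_spec hU hUV hη hfr
  set w := truncOn U η u with hw
  have hw0 : 0 ≤ ∫ x, w x ^ 2 := integral_nonneg fun x => sq_nonneg _
  have hI : Integrable fun x => w x ^ 2 :=
    (hC.continuous.pow 2).integrable_of_hasCompactSupport (hasCompactSupport_sq hcs)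
  have h1 : (lam₂ - lam) * ∫ x, w x ^ 2 ≤ 2 * η * lam * volume.real U := by
    have h1 : μ * (∫ x, w x ^ 2) ≤ lam * ∫ x, w x ^ 2 := by gcongr
    have h2 : 2 * η * μ * volume.real U ≤ 2 * η * lam * volume.real U := by gcongr
    have := hray w hC hcs hts
    linarith
  have h2 : ∫ x, w x ^ 2 ≤ 2 * η * lam * volume.real U / (lam₂ - lam) := by
    rw [le_div_iff₀ hgap]; linarith
  have hfin : volume U ≠ ⊤ := hb.measure_lt_top.ne
  have hIc : IntegrableOn (fun _ => σ + 2 * η : ESp k → ℝ) U := integrableOn_const hfin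
  have h3 : ∫ x in U, u x ≤ ∫ x in U, ((σ + 2 * η) + w x ^ 2 / (4 * σ)) := by
    refine setIntegral_mono_on hu.integrable.integrableOn (hIc.add (hI.div_const _).integrableOn)
      hU.measurableSet fun x hx => ?_
    have h4 := (abs_le.1 (hclose x hx)).2
    have h5 : w x ≤ σ + w x ^ 2 / (4 * σ) := by
      have : σ + w x ^ 2 / (4 * σ) - w x = (w x - 2 * σ) ^ 2 / (4 * σ) := by field_simp; ring
      have h6 : 0 ≤ (w x - 2 * σ) ^ 2 / (4 * σ) := by positivity
      linarith
    linarith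
  have h4 : ∫ x in U, ((σ + 2 * η) + w x ^ 2 / (4 * σ)) ≤
      (σ + 2 * η) * volume.real U + (∫ x, w x ^ 2) / (4 * σ) := by
    rw [integral_add hIc (hI.div_const _).integrableOn, setIntegral_const, integral_div, smul_eq_mul,
      mul_comm]
    exact add_le_add le_rfl (div_le_div_of_nonneg_right (setIntegral_le_integral hI
      (Eventually.of_forall fun x => sq_nonneg _)) (by positivity))
  calc ∫ x in U, u x ≤ (σ + 2 * η) * volume.real U + (∫ x, w x ^ 2) / (4 * σ) := h3.trans h4
    _ ≤ (σ + 2 * η) * volume.real U + 2 * η * lam * volume.real U / (lam₂ - lam) / (4 * σ) := by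
      gcongr
    _ = σ * volume.real U +
        η * (2 * volume.real U + 2 * lam * volume.real U / (lam₂ - lam) / (4 * σ)) := by ring
    _ ≤ s := by linarith

/-- A solution with eigenvalue below that of `U` cannot vanish on the boundary of a nonempty open
subset of `U`. -/
lemma eq_empty_of_frontier (hg : UnitSolution U lam g) (hu : UnitSolution V μ u) (hμ : μ < lam)
    {B : Set (ESp k)} (hB : IsOpen B) (hBU : B ⊆ U) (hBV : B ⊆ V)
    (hfr : ∀ x ∈ frontier B, u x = 0) : B = ∅ := by
  by_contra hne
  obtain ⟨p, hp⟩ := nonempty_iff_ne_empty.2 hne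
  set a := u p with ha
  have ha0 : 0 < a := hu.pos p (hBV hp)
  obtain ⟨t, ht, htB⟩ := Metric.isOpen_iff.1 (hB.inter (isOpen_lt continuous_const hu.continuous))
    p ⟨hp, show a / 2 < u p by linarith⟩
  have hv : 0 < volume.real (ball p t) :=
    ENNReal.toReal_pos (measure_ball_pos volume p ht).ne' measure_ball_lt_top.ne
  have hs : 0 < (lam - μ) * ((a / 4) ^ 2 * volume.real (ball p t)) / 3 := by
    have : 0 < lam - μ := by linarith
    positivity
  obtain ⟨η₁, hη₁, hη1, -⟩ := exists_pos_mul_le hs (μ * volume.real B)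
  set η := min η₁ (a / 8) with hη
  have hη0 : 0 < η := lt_min hη₁ (by positivity)
  have hηa : η ≤ a / 8 := min_le_right _ _
  have hηη : η ≤ η₁ := min_le_left _ _
  obtain ⟨hC, hcs, hts, habs, hclose, hen⟩ := hu.truncOn_spec hB hBV hη0
    fun x hx => by rw [hfr x hx]; exact hη0
  set w := truncOn B η u with hw
  have hray := mul_integral_sq_le hg.isOpen hg.contDiffOn hg.pos hg.lap_eq hC hcs (hts.trans hBU)
  have hI : Integrable fun x => w x ^ 2 :=
    (hC.continuous.pow 2).integrable_of_hasCompactSupport (hasCompactSupport_sq hcs)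
  have hlow : (a / 4) ^ 2 * volume.real (ball p t) ≤ ∫ x, w x ^ 2 := by
    calc (a / 4) ^ 2 * volume.real (ball p t) = ∫ _ in ball p t, (a / 4) ^ 2 := by
          rw [setIntegral_const, smul_eq_mul, mul_comm]
      _ ≤ ∫ x in ball p t, w x ^ 2 := by
          refine setIntegral_mono_on (integrableOn_const measure_ball_lt_top.ne) hI.integrableOn
            measurableSet_ball fun x hx => ?_
          have h1 := htB hx
          have h2 := (abs_le.1 (hclose x h1.1)).2
          have h3 : a / 2 < u x := h1.2
          have : a / 4 ≤ w x := by linarith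
          gcongr
      _ ≤ _ := setIntegral_le_integral hI (Eventually.of_forall fun x => sq_nonneg _)
  have hvB : 0 ≤ volume.real B := measureReal_nonneg
  have h1 : η * (μ * volume.real B) ≤ η₁ * (μ * volume.real B) := by
    have := hu.eig_nonneg
    gcongr
  have h2 : (lam - μ) * ((a / 4) ^ 2 * volume.real (ball p t)) ≤ (lam - μ) * ∫ x, w x ^ 2 := by
    have : 0 ≤ lam - μ := by linarith
    gcongr
  linarith

end UnitSolution

/-! ### Density of smooth test functions -/

/-- Uniform approximation of a compactly supported `C¹` function and of its derivative by smooth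
functions supported in a neighbourhood of its support. -/
lemma exists_smooth_approx {w : ESp k → ℝ} (hw : ContDiff ℝ 1 w) (hwc : HasCompactSupport w)
    {δ e : ℝ} (hδ : 0 < δ) (he : 0 < e) :
    ∃ f : ESp k → ℝ, ContDiff ℝ (⊤ : ℕ∞) f ∧ (∀ x ∉ cthickening δ (tsupport w), f x = 0) ∧
      ∀ x, |f x - w x| ≤ e ∧ ‖fderiv ℝ f x - fderiv ℝ w x‖ ≤ e := by
  have hu1 : UniformContinuous w := hw.continuous.uniformContinuous_of_tendsto_cocompact
    (x := 0) hwc.is_zero_at_infty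
  have hdc : Continuous (fderiv ℝ w) := hw.continuous_fderiv one_ne_zero
  have hu2 : UniformContinuous (fderiv ℝ w) := hdc.uniformContinuous_of_tendsto_cocompact
    (x := 0) (hwc.fderiv ℝ).is_zero_at_infty
  obtain ⟨δ₁, hδ₁, h1⟩ := Metric.uniformContinuous_iff_le.1 hu1 e he
  obtain ⟨δ₂, hδ₂, h2⟩ := Metric.uniformContinuous_iff_le.1 hu2 e he
  set t := min δ (min δ₁ δ₂) with ht
  have ht0 : 0 < t := lt_min hδ (lt_min hδ₁ hδ₂)
  have htδ : t ≤ δ := min_le_left _ _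
  have ht1 : t ≤ δ₁ := (min_le_right _ _).trans (min_le_left _ _)
  have ht2 : t ≤ δ₂ := (min_le_right _ _).trans (min_le_right _ _)
  let χ : ContDiffBump (0 : ESp k) := ⟨t / 2, t, by positivity, by linarith⟩
  set f : ESp k → ℝ := convolution (χ.normed volume) w (ContinuousLinearMap.lsmul ℝ ℝ) volume with hf
  have hder : ∀ x, fderiv ℝ f x = convolution (χ.normed volume) (fderiv ℝ w)
      (ContinuousLinearMap.lsmul ℝ ℝ) volume x := by
    intro x
    rw [(hwc.hasFDerivAt_convolution_right (ContinuousLinearMap.lsmul ℝ ℝ)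
      (χ.integrable_normed (μ := volume)).locallyIntegrable hw x).fderiv]
    rw [convolution_def, convolution_def]
    rfl
  refine ⟨f, ?_, ?_, ?_⟩
  · exact χ.hasCompactSupport_normed.contDiff_convolution_left _ χ.contDiff_normed
      hw.continuous.locallyIntegrable
  · intro x hx
    have hz : ∀ y ∈ ball x χ.rOut, w y = 0 := fun y hy => by
      by_contra hne
      refine hx (mem_cthickening_of_dist_le x y δ _ (subset_tsupport _ hne) ?_)
      rw [dist_comm]
      exact (le_of_lt (mem_ball.1 hy)).trans htδ
    have hx0 : w x = 0 := hz x (mem_ball_self χ.rOut_pos)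
    rw [hf, χ.normed_convolution_eq_right fun y hy => by rw [hz y hy, hx0], hx0]
  · intro x
    rw [hder x, ← Real.dist_eq, ← dist_eq_norm]
    exact ⟨χ.dist_normed_convolution_le hw.continuous.aestronglyMeasurable fun y hy =>
        h1 ((le_of_lt (mem_ball.1 hy)).trans ht1),
      χ.dist_normed_convolution_le hdc.aestronglyMeasurable fun y hy =>
        h2 ((le_of_lt (mem_ball.1 hy)).trans ht2)⟩

lemma dirEig1_mul_le_of_smooth {U : Set (ESp k)} {f : ESp k → ℝ}
    (hf : ContDiff ℝ (⊤ : ℕ∞) f) (hfc : HasCompactSupport f) (hfU : tsupport f ⊆ U) :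
    dirEig1 U * ∫ x, f x ^ 2 ≤ ∫ x, ‖fderiv ℝ f x‖ ^ 2 := by
  by_cases hne : f = 0
  · subst hne
    simp
  have h1 : ∫ x in U, f x ^ 2 = ∫ x, f x ^ 2 := setIntegral_eq_integral_of_forall_compl_eq_zero
    fun x hx => by rw [image_eq_zero_of_notMem_tsupport fun h => hx (hfU h)]; norm_num
  have h2 : ∫ x in U, ‖fderiv ℝ f x‖ ^ 2 = ∫ x, ‖fderiv ℝ f x‖ ^ 2 :=
    setIntegral_eq_integral_of_forall_compl_eq_zero fun x hx => by
      rw [image_eq_zero_of_notMem_tsupport fun h => hx (hfU (tsupport_fderiv_subset ℝ h))]; norm_num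
  have hle : dirEig1 U ≤ (∫ x, ‖fderiv ℝ f x‖ ^ 2) / ∫ x, f x ^ 2 := by
    rw [← h1, ← h2]
    refine csInf_le ⟨0, ?_⟩ ⟨f, hf, hfc, hfU, hne, rfl⟩
    rintro r ⟨u, -, -, -, -, rfl⟩
    exact div_nonneg (integral_nonneg fun x => by positivity)
      (integral_nonneg fun x => by positivity)
  have h0 : 0 ≤ ∫ x, f x ^ 2 := integral_nonneg fun x => sq_nonneg _
  rcases h0.eq_or_lt with h | h
  · rw [← h, mul_zero]
    exact integral_nonneg fun x => by positivity
  · exact (le_div_iff₀ h).1 hle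

/-- The first Dirichlet eigenvalue bounds the Rayleigh quotient of `C²` test functions. -/
lemma dirEig1_mul_integral_sq_le {U : Set (ESp k)} (hU : IsOpen U) {w : ESp k → ℝ}
    (hw : ContDiff ℝ 2 w) (hwc : HasCompactSupport w) (hwU : tsupport w ⊆ U) :
    dirEig1 U * ∫ x, w x ^ 2 ≤ ∫ x, gradSq w x := by
  have hw1 : ContDiff ℝ 1 w := hw.of_le (by norm_num)
  obtain ⟨δ, hδ, hδU⟩ := hwc.isCompact.exists_cthickening_subset_open hU hwU
  have hK : IsCompact (cthickening δ (tsupport w)) := hwc.isCompact.cthickening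
  set K := cthickening δ (tsupport w) with hKdef
  have hpos : ∀ n : ℕ, (0 : ℝ) < 1 / ((n : ℝ) + 1) := fun n => by positivity
  choose F hFs hF0 hFa using fun n : ℕ => exists_smooth_approx hw1 hwc hδ (hpos n)
  have hts : ∀ n, tsupport (F n) ⊆ K := fun n =>
    closure_minimal (fun x hx => by_contra fun h => hx (hF0 n x h)) isClosed_cthickening
  have hFc : ∀ n, HasCompactSupport (F n) := fun n =>
    HasCompactSupport.intro hK (hF0 n)
  obtain ⟨M, hM⟩ := hwc.exists_bound_of_continuous hw1.continuous
  obtain ⟨M', hM'⟩ := (hwc.fderiv ℝ).exists_bound_of_continuous (hw1.continuous_fderiv one_ne_zero)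
  have hle1 : ∀ n : ℕ, 1 / ((n : ℝ) + 1) ≤ 1 := fun n => by
    rw [div_le_one (by positivity)]; linarith [n.cast_nonneg (α := ℝ)]
  have hlim : Tendsto (fun n : ℕ => 1 / ((n : ℝ) + 1)) atTop (nhds 0) :=
    tendsto_one_div_add_atTop_nhds_zero_nat
  have hKi : ∀ c : ℝ, Integrable (K.indicator fun _ => c) := fun c =>
    (integrable_indicator_iff hK.measurableSet).2 (integrableOn_const hK.measure_lt_top.ne)
  have hT1 : Tendsto (fun n => ∫ x, F n x ^ 2) atTop (nhds (∫ x, w x ^ 2)) := by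
    refine tendsto_integral_of_dominated_convergence (K.indicator fun _ => (M + 1) ^ 2)
      (fun n => ((hFs n).continuous.pow 2).aestronglyMeasurable) (hKi _)
      (fun n => Eventually.of_forall fun x => ?_) (Eventually.of_forall fun x => ?_)
    · by_cases hx : x ∈ K
      · rw [indicator_of_mem hx, norm_pow]
        have h1 : |F n x| ≤ |w x| + |F n x - w x| := by
          have := abs_add_le (w x) (F n x - w x)
          simpa using this
        have h2 := hM x
        rw [Real.norm_eq_abs] at h2 ⊢
        have : |F n x| ≤ M + 1 := by linarith [(hFa n x).1, hle1 n]
        gcongr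
      · rw [indicator_of_notMem hx, hF0 n x hx]; norm_num
    · refine Tendsto.pow ?_ 2
      rw [tendsto_iff_dist_tendsto_zero]
      exact squeeze_zero (fun _ => dist_nonneg) (fun n => (hFa n x).1) hlim
  have hT2 : Tendsto (fun n => ∫ x, ‖fderiv ℝ (F n) x‖ ^ 2) atTop
      (nhds (∫ x, ‖fderiv ℝ w x‖ ^ 2)) := by
    refine tendsto_integral_of_dominated_convergence (K.indicator fun _ => (M' + 1) ^ 2)
      (fun n => (((hFs n).continuous_fderiv (by norm_num)).norm.pow 2).aestronglyMeasurable) (hKi _)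
      (fun n => Eventually.of_forall fun x => ?_) (Eventually.of_forall fun x => ?_)
    · by_cases hx : x ∈ K
      · rw [indicator_of_mem hx, norm_pow, norm_norm]
        have h1 : ‖fderiv ℝ (F n) x‖ ≤ ‖fderiv ℝ w x‖ + ‖fderiv ℝ (F n) x - fderiv ℝ w x‖ := by
          have := norm_add_le (fderiv ℝ w x) (fderiv ℝ (F n) x - fderiv ℝ w x)
          simpa using this
        have : ‖fderiv ℝ (F n) x‖ ≤ M' + 1 := by linarith [(hFa n x).2, hle1 n, hM' x]
        gcongr
      · rw [indicator_of_notMem hx, image_eq_zero_of_notMem_tsupport fun h =>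
          hx (hts n (tsupport_fderiv_subset ℝ h))]
        norm_num
    · refine Tendsto.pow (Tendsto.norm ?_) 2
      rw [tendsto_iff_dist_tendsto_zero]
      exact squeeze_zero (fun _ => dist_nonneg)
        (fun n => by rw [dist_eq_norm]; exact (hFa n x).2) hlim
  simp_rw [← norm_fderiv_sq]
  exact le_of_tendsto_of_tendsto' (hT1.const_mul _) hT2 fun n =>
    dirEig1_mul_le_of_smooth (hFs n) (hFc n) ((hts n).trans hδU)

/-! ### Decay of solutions near a thin tube -/

/-- The fraction of the averaging kernel carried by a small ball well inside the unit ball. -/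
def gapC (k : ℕ) : ℝ := volume.real (ball (0 : ESp k) (1 / 16)) / (2 * massK k)

lemma gapC_pos : 0 < gapC k := by
  have h1 : 0 < volume.real (ball (0 : ESp k) (1 / 16)) :=
    ENNReal.toReal_pos (measure_ball_pos volume _ (by norm_num)).ne' measure_ball_lt_top.ne
  have := massK_pos (k := k)
  unfold gapC
  positivity

lemma half_mul_volume_le {F : ESp k → ℝ} (hF : Continuous F) {c : ESp k} {S : ℝ} (hS : 0 ≤ S)
    (hc : ‖c‖ ≤ 5 / 8) (h0 : ∀ z, kerK z ≠ 0 → 0 ≤ F z) (hFS : ∀ z ∈ ball c (1 / 16), S ≤ F z) :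
    S * (volume.real (ball (0 : ESp k) (1 / 16)) / 2) ≤ ∫ z, F z * kerK z := by
  have hI : Integrable fun z => F z * kerK z :=
    (hF.mul continuous_kerK).integrable_of_hasCompactSupport hasCompactSupport_kerK.mul_left
  have hnn : ∀ z, 0 ≤ F z * kerK z := fun z => by
    by_cases hz : kerK z = 0
    · simp [hz]
    · exact mul_nonneg (h0 z hz) (kerK_nonneg z)
  have hvol : volume.real (ball c (1 / 16)) = volume.real (ball (0 : ESp k) (1 / 16)) := by
    rw [Measure.real, Measure.real, Measure.addHaar_ball_center]
  calc S * (volume.real (ball (0 : ESp k) (1 / 16)) / 2) = ∫ _ in ball c (1 / 16), S * (1 / 2) := by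
        rw [setIntegral_const, smul_eq_mul, hvol]; ring
    _ ≤ ∫ z in ball c (1 / 16), F z * kerK z := by
        refine setIntegral_mono_on (integrableOn_const measure_ball_lt_top.ne) hI.integrableOn
          measurableSet_ball fun z hz => ?_
        have hzn : ‖z‖ ≤ 11 / 16 := by
          have h1 := norm_add_le (z - c) c
          rw [sub_add_cancel, ← dist_eq_norm] at h1
          linarith [mem_ball.1 hz]
        have hk : 1 / 2 ≤ kerK z := by
          refine le_trans ?_ (le_max_left _ _)
          nlinarith [norm_nonneg z]
        exact mul_le_mul (hFS z hz) hk (by norm_num) (hS.trans (hFS z hz))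
    _ ≤ _ := setIntegral_le_integral hI (Eventually.of_forall hnn)

lemma gapC_le_one : gapC k ≤ 1 := by
  have h := half_mul_volume_le (k := k) (F := fun _ => 1) (c := 0) continuous_const zero_le_one
    (by norm_num) (fun _ _ => zero_le_one) fun _ _ => le_rfl
  have hm := massK_pos (k := k)
  simp only [one_mul] at h
  rw [← massK] at h
  rw [gapC, div_le_one (by positivity)]
  linarith

/-- The average of a function bounded by `S` and vanishing on a sizeable ball is at most
a fixed fraction of `S`. -/
lemma avg_le_of_vanish {f : ESp k → ℝ} (hf : Continuous f) {x b : ESp k} {r S : ℝ} (hr : 0 < r)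
    (hS : 0 ≤ S) (hfS : ∀ y ∈ closedBall x r, f y ≤ S) (hb : ‖b - x‖ ≤ 5 / 8 * r)
    (hfb : ∀ y ∈ ball b (r / 16), f y = 0) : avg f x r ≤ (1 - gapC k) * S := by
  have hm := massK_pos (k := k)
  have hc : ‖r⁻¹ • (b - x)‖ ≤ 5 / 8 := by
    rw [norm_smul, norm_inv, Real.norm_of_nonneg hr.le, inv_mul_le_iff₀ hr]
    linarith
  have h := half_mul_volume_le (F := fun z => S - f (x + r • z)) (by fun_prop) hS hc
    (fun z hz => sub_nonneg.2 (hfS _ (add_smul_mem_closedBall hr.le hz))) (fun z hz => by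
      rw [hfb, sub_zero]
      have e1 : x + r • z - b = r • (z - r⁻¹ • (b - x)) := by
        rw [smul_sub, smul_inv_smul₀ hr.ne']; abel
      rw [mem_ball, dist_eq_norm, e1, norm_smul, Real.norm_of_nonneg hr.le, ← dist_eq_norm]
      have := mem_ball.1 hz
      calc r * dist z (r⁻¹ • (b - x)) < r * (1 / 16) := by gcongr
        _ = r / 16 := by ring)
  simp only [sub_mul] at h
  rw [integral_sub (integrable_kerK.const_mul S) (integrable_mul_kerK hf x r), integral_const_mul,
    ← massK] at h
  rw [avg, div_le_iff₀ hm]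
  have e2 : (1 - gapC k) * S * massK k =
      S * massK k - S * (volume.real (ball (0 : ESp k) (1 / 16)) / 2) := by
    rw [gapC]; field_simp
  linarith

section coordinates

variable {m : ℕ}

lemma norm_sq_eq_add_primeNorm_sq (x : ESp (m + 2)) : ‖x‖ ^ 2 = x 0 ^ 2 + primeNorm x ^ 2 := by
  rw [EuclideanSpace.norm_sq_eq, Fin.sum_univ_succ, primeNorm,
    Real.sq_sqrt (Finset.sum_nonneg fun i _ => sq_nonneg _)]
  simp

lemma primeNorm_eq_norm (x : ESp (m + 2)) :
    primeNorm x = ‖(WithLp.toLp 2 fun i : Fin (m + 1) => x i.succ : ESp (m + 1))‖ := by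
  rw [EuclideanSpace.norm_eq, primeNorm]
  simp

lemma primeNorm_nonneg (x : ESp (m + 2)) : 0 ≤ primeNorm x := Real.sqrt_nonneg _

lemma primeNorm_add_le (x y : ESp (m + 2)) : primeNorm (x + y) ≤ primeNorm x + primeNorm y := by
  simp only [primeNorm_eq_norm]
  exact norm_add_le (WithLp.toLp 2 fun i : Fin (m + 1) => x i.succ : ESp (m + 1))
    (WithLp.toLp 2 fun i : Fin (m + 1) => y i.succ)

lemma primeNorm_le_norm (x : ESp (m + 2)) : primeNorm x ≤ ‖x‖ := by
  refine le_of_sq_le_sq ?_ (norm_nonneg x)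
  rw [norm_sq_eq_add_primeNorm_sq]
  nlinarith [sq_nonneg (x 0)]

lemma abs_zero_coord_le_norm (x : ESp (m + 2)) : |x 0| ≤ ‖x‖ := by
  refine abs_le_of_sq_le_sq ?_ (norm_nonneg x)
  rw [norm_sq_eq_add_primeNorm_sq]
  nlinarith [sq_nonneg (primeNorm x)]

lemma norm_le_abs_add_primeNorm (x : ESp (m + 2)) : ‖x‖ ≤ |x 0| + primeNorm x := by
  refine le_of_sq_le_sq ?_ (add_nonneg (abs_nonneg _) (primeNorm_nonneg x))
  rw [norm_sq_eq_add_primeNorm_sq, ← sq_abs (x 0)]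
  nlinarith [abs_nonneg (x 0), primeNorm_nonneg x]

lemma primeNorm_le_add_norm_sub (x y : ESp (m + 2)) : primeNorm x ≤ primeNorm y + ‖x - y‖ := by
  have h := primeNorm_add_le y (x - y)
  rw [add_sub_cancel] at h
  linarith [primeNorm_le_norm (x - y)]

lemma primeNorm_neg (x : ESp (m + 2)) : primeNorm (-x) = primeNorm x := by
  simp [primeNorm]

end coordinates

namespace UnitSolution

variable {m : ℕ}

/-- One step of the decay towards the axis of a tube around which the solution vanishes. -/
lemma le_of_tube {V : Set (ESp (m + 2))} {μ A ξ r S : ℝ} {u : ESp (m + 2) → ℝ}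
    (hu : UnitSolution V μ u) (hμ : μ ≤ A) (hr : 0 < r) (hr1 : r ≤ 1) (hrξ : r ≤ ξ) (hS : 0 ≤ S)
    (hvan : ∀ x : ESp (m + 2), -1 < x 0 → x 0 < 1 → r ≤ primeNorm x → primeNorm x < 3 * ξ → u x = 0)
    (hle : ∀ x : ESp (m + 2), -1 - 9 * r ≤ x 0 → x 0 ≤ 1 + 9 * r → primeNorm x ≤ 9 * r → u x ≤ S)
    {x : ESp (m + 2)} (hx1 : -1 - r ≤ x 0) (hx2 : x 0 ≤ 1 + r) (hx3 : primeNorm x ≤ r) :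
    u x ≤ (1 - gapC (m + 2)) * S + A * meanC (m + 2) * (8 * r) ^ 2 := by
  refine (hu.le_avg hμ x (by positivity : 0 ≤ 8 * r)).trans ?_
  gcongr
  set t := max (-1 + r) (min (1 - r) (x 0)) with ht
  have ht1 : -1 + r ≤ t := le_max_left _ _
  have ht2 : t ≤ 1 - r := max_le (by linarith) (min_le_left _ _)
  have ht3 : |t - x 0| ≤ 2 * r := by
    rw [abs_le]
    rcases max_cases (-1 + r) (min (1 - r) (x 0)) with h | h <;>
    rcases min_cases (1 - r) (x 0) with h' | h' <;> constructor <;> linarith [h.1, h.2, h'.1, h'.2]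
  set b : ESp (m + 2) := EuclideanSpace.single 0 t + EuclideanSpace.single 1 (2 * r) with hb
  have hb0 : b 0 = t := by simp [hb]
  have hbp : primeNorm b = 2 * r := by
    have : ∀ i : Fin (m + 1), b i.succ ^ 2 = if i = 0 then (2 * r) ^ 2 else 0 := by
      intro i
      have h1 : (i.succ : Fin (m + 2)) ≠ 0 := Fin.succ_ne_zero i
      by_cases hi : i = 0
      · subst hi; simp [hb]
      · have h2 : (i.succ : Fin (m + 2)) ≠ 1 := fun h => hi (Fin.succ_injective _ h)
        simp [hb, h1, h2, hi]
    rw [primeNorm, Finset.sum_congr rfl fun i _ => this i, Finset.sum_ite_eq']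
    simp [Real.sqrt_sq (by positivity : 0 ≤ 2 * r)]
  refine avg_le_of_vanish (b := b) hu.continuous (by positivity) hS ?_ ?_ ?_
  · intro y hy
    have hyn : ‖y - x‖ ≤ 8 * r := by rw [← dist_eq_norm]; exact hy
    have h0 := abs_le.1 ((abs_zero_coord_le_norm (y - x)).trans hyn)
    rw [PiLp.sub_apply] at h0
    have hp := primeNorm_le_add_norm_sub y x
    exact hle y (by linarith [h0.1]) (by linarith [h0.2]) (by linarith)
  · have h1 := norm_le_abs_add_primeNorm (b - x)
    have h2 := primeNorm_add_le b (-x)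
    rw [primeNorm_neg, ← sub_eq_add_neg] at h2
    rw [PiLp.sub_apply, hb0] at h1
    linarith
  · intro y hy
    have hyn : ‖y - b‖ < r / 2 := by
      rw [← dist_eq_norm]
      have := mem_ball.1 hy
      linarith
    have h0 := abs_lt.1 ((abs_zero_coord_le_norm (y - b)).trans_lt hyn)
    rw [PiLp.sub_apply, hb0] at h0
    have hp := primeNorm_le_add_norm_sub y b
    have hq := primeNorm_le_add_norm_sub b y
    rw [norm_sub_rev] at hq
    exact hvan y (by linarith [h0.1]) (by linarith [h0.2]) (by linarith) (by linarith)

/-- Solutions vanishing around a thin tube are uniformly small near its axis. -/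
lemma exists_neck {A ξ η : ℝ} (hA : 0 ≤ A) (hξ : 0 < ξ) (hη : 0 < η) :
    ∃ r > 0, ∀ (V : Set (ESp (m + 2))) (μ : ℝ) (u : ESp (m + 2) → ℝ), UnitSolution V μ u → μ ≤ A →
      (∀ x : ESp (m + 2), -1 < x 0 → x 0 < 1 → r ≤ primeNorm x → primeNorm x < 3 * ξ → u x = 0) →
      ∀ x : ESp (m + 2), -1 ≤ x 0 → x 0 ≤ 1 → primeNorm x ≤ r → u x < η := by
  set c := gapC (m + 2) with hc
  have hc0 : 0 < c := gapC_pos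
  have hc1 : c ≤ 1 := gapC_le_one
  have hC : 0 ≤ A * meanC (m + 2) := mul_nonneg hA meanC_nonneg
  obtain ⟨q, hq, hq1, -⟩ := exists_pos_mul_le (half_pos hη) (A * meanC (m + 2) * 64 / c)
  set r₀ := min q (min ξ 1) with hr₀
  have hr₀0 : 0 < r₀ := lt_min hq (lt_min hξ one_pos)
  have hr₀q : r₀ ≤ q := min_le_left _ _
  have hr₀ξ : r₀ ≤ ξ := (min_le_right _ _).trans (min_le_left _ _)
  have hr₀1 : r₀ ≤ 1 := (min_le_right _ _).trans (min_le_right _ _)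
  obtain ⟨j, hj⟩ := exists_pow_lt_of_lt_one (half_pos hη) (by linarith : 1 - c < 1)
  set D := A * meanC (m + 2) * (8 * r₀) ^ 2 with hD
  have hD0 : 0 ≤ D := mul_nonneg hC (sq_nonneg _)
  have hDc : D / c ≤ η / 2 := by
    have : D / c = r₀ ^ 2 * (A * meanC (m + 2) * 64 / c) := by rw [hD]; ring
    rw [this]
    refine le_trans ?_ hq1
    have h1 : r₀ ^ 2 ≤ q := by nlinarith
    gcongr
  refine ⟨r₀ / 9 ^ j, by positivity, fun V μ u hu hμ hvan x hx1 hx2 hx3 => ?_⟩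
  have key : ∀ i ≤ j, ∀ x : ESp (m + 2), -1 - r₀ / 9 ^ i ≤ x 0 → x 0 ≤ 1 + r₀ / 9 ^ i →
      primeNorm x ≤ r₀ / 9 ^ i → u x ≤ (1 - c) ^ i + D / c := by
    intro i
    induction i with
    | zero =>
      intro _ x _ _ _
      have : 0 ≤ D / c := by positivity
      simpa using (hu.le_one x).trans (by linarith)
    | succ i ih =>
      intro hij x h1 h2 h3
      have hr : 0 < r₀ / 9 ^ (i + 1) := by positivity
      have hle : r₀ / 9 ^ (i + 1) ≤ r₀ := div_le_self hr₀0.le (one_le_pow₀ (by norm_num))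
      have h9 : 9 * (r₀ / 9 ^ (i + 1)) = r₀ / 9 ^ i := by field_simp; ring
      have hS : 0 ≤ (1 - c) ^ i + D / c := by
        have : 0 ≤ 1 - c := by linarith
        positivity
      have hjr : r₀ / 9 ^ j ≤ r₀ / 9 ^ (i + 1) := by
        gcongr
        norm_num
      have := hu.le_of_tube hμ hr (hle.trans hr₀1) (hle.trans hr₀ξ) hS
        (fun y a1 a2 a3 a4 => hvan y a1 a2 (hjr.trans a3) a4)
        (by rw [h9]; exact ih (by omega)) h1 h2 h3
      refine this.trans ?_
      calc (1 - c) * ((1 - c) ^ i + D / c) + A * meanC (m + 2) * (8 * (r₀ / 9 ^ (i + 1))) ^ 2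
          ≤ (1 - c) * ((1 - c) ^ i + D / c) + D := by rw [hD]; gcongr
        _ = (1 - c) ^ (i + 1) + D / c := by field_simp; ring
  have hrj : 0 < r₀ / 9 ^ j := by positivity
  have := key j le_rfl x (by linarith) (by linarith) hx3
  linarith

end UnitSolution

/-! ### Geometry of the dumbbell -/

namespace Dumbbell

variable {m : ℕ} (d : Dumbbell m)

lemma exists_ρ_le : ∃ C > 0, ∀ q ∈ Icc (-2 : ℝ) 0, d.ρ q ≤ C := by
  have hc : ContinuousOn d.ρ (Icc (-1 : ℝ) 0) :=
    d.ρ_cont.mono fun q hq => ⟨by linarith [hq.1], hq.2⟩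
  obtain ⟨C, hC⟩ := isCompact_Icc.bddAbove_image hc
  refine ⟨max (max C 1) (d.ρ (-2)), lt_max_of_lt_left (lt_max_of_lt_right one_pos), fun q hq => ?_⟩
  rcases le_or_gt (-1) q with h | h
  · exact (hC (mem_image_of_mem _ ⟨h, hq.2⟩)).trans ((le_max_left _ _).trans (le_max_left _ _))
  · rcases hq.1.eq_or_lt with h' | h'
    · rw [← h']; exact le_max_right _ _
    · rw [d.ρ_one q ⟨h', h⟩]; exact (le_max_right _ _).trans (le_max_left _ _)

/-- An upper bound for the profile of the connector. -/
def profileBound : ℝ := d.exists_ρ_le.choose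

lemma profileBound_pos : 0 < d.profileBound := d.exists_ρ_le.choose_spec.1

lemma ρ_le_profileBound {q : ℝ} (h1 : -2 ≤ q) (h2 : q ≤ 0) : d.ρ q ≤ d.profileBound :=
  d.exists_ρ_le.choose_spec.2 q ⟨h1, h2⟩

variable {d}

lemma le_zero_coord_of_mem_Q {ε : ℝ} (hε1 : ε ≤ 1) {x : ESp (m + 2)} (hε : 0 < ε)
    (hx : x ∈ d.Q ε) : -1 ≤ x 0 ∧ x 0 ≤ 1 := by
  rcases hx with (hx | hx) | hx
  · exact ⟨hx.1, by linarith [hx.2.1]⟩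
  · exact ⟨by linarith [hx.1], by linarith [hx.2.1]⟩
  · exact ⟨by linarith [hx.1], hx.2.1⟩

lemma primeNorm_lt_of_mem_Q {ε : ℝ} (hε : 0 < ε) {x : ESp (m + 2)}
    (hx : x ∈ d.Q ε) : primeNorm x < (d.profileBound + 1) * ε := by
  have hC := d.profileBound_pos
  have key : ∀ q, -2 ≤ q → q ≤ 0 → primeNorm x < ε * d.ρ q →
      primeNorm x < (d.profileBound + 1) * ε := fun q h1 h2 h => by
    nlinarith [d.ρ_le_profileBound h1 h2]
  rcases hx with (hx | hx) | hx
  · refine key _ ?_ ?_ hx.2.2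
    · rw [le_div_iff₀ hε]; linarith [hx.2.1]
    · exact div_nonpos_of_nonpos_of_nonneg (by linarith [hx.1]) hε.le
  · nlinarith [hx.2.2]
  · refine key _ ?_ ?_ hx.2.2
    · rw [le_div_iff₀ hε]; linarith [hx.1]
    · exact div_nonpos_of_nonpos_of_nonneg (by linarith [hx.2.1]) hε.le

lemma zero_coord_lt_of_mem_Ω₁ {x : ESp (m + 2)} (hx : x ∈ d.Ω₁) (hp : primeNorm x < 3 * d.ξ) :
    x 0 < -1 := by
  by_contra! h
  have h1 : x ∈ {x : ESp (m + 2) | x 0 = -1 ∧ primeNorm x < 3 * d.ξ} :=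
    d.flat₁ ▸ ⟨subset_closure hx, h, hp⟩
  have h2 := d.flat₁' h1
  rw [d.open₁.frontier_eq] at h2
  exact h2.2 hx

lemma lt_zero_coord_of_mem_Ω₂ {x : ESp (m + 2)} (hx : x ∈ d.Ω₂) (hp : primeNorm x < 3 * d.ξ) :
    1 < x 0 := by
  by_contra! h
  have h1 : x ∈ {x : ESp (m + 2) | x 0 = 1 ∧ primeNorm x < 3 * d.ξ} :=
    d.flat₂ ▸ ⟨subset_closure hx, h, hp⟩
  have h2 := d.flat₂' h1
  rw [d.open₂.frontier_eq] at h2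
  exact h2.2 hx

lemma subset_Ωε₁ (ε : ℝ) : d.Ω₁ ⊆ d.Ωε ε := subset_union_left.trans subset_union_left

lemma subset_Ωε₂ (ε : ℝ) : d.Ω₂ ⊆ d.Ωε ε := subset_union_right.trans subset_union_left

lemma isBounded_Q {ε : ℝ} (hε : 0 < ε) (hε1 : ε ≤ 1) : Bornology.IsBounded (d.Q ε) := by
  refine (isBounded_closedBall (x := (0 : ESp (m + 2))) (r := 1 + (d.profileBound + 1) * ε)).subset
    fun x hx => ?_
  rw [mem_closedBall_zero_iff]
  have h1 := abs_le.2 (le_zero_coord_of_mem_Q hε1 hε hx)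
  linarith [norm_le_abs_add_primeNorm x, primeNorm_lt_of_mem_Q hε hx]

lemma isBounded_Ωε {ε : ℝ} (hε : 0 < ε) (hε1 : ε ≤ 1) : Bornology.IsBounded (d.Ωε ε) :=
  (d.bounded₁.union d.bounded₂).union (isBounded_Q hε hε1)

lemma notMem_Ωε {ε : ℝ} (hε : 0 < ε) {x : ESp (m + 2)} (h1 : -1 < x 0) (h2 : x 0 < 1)
    (h3 : (d.profileBound + 1) * ε ≤ primeNorm x) (h4 : primeNorm x < 3 * d.ξ) : x ∉ d.Ωε ε := by
  rintro ((hx | hx) | hx)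
  · linarith [zero_coord_lt_of_mem_Ω₁ hx h4]
  · linarith [lt_zero_coord_of_mem_Ω₂ hx h4]
  · linarith [primeNorm_lt_of_mem_Q hε hx]

/-- The centre of the left end of the connector. -/
def leftEnd (m : ℕ) : ESp (m + 2) := EuclideanSpace.single 0 (-1)

@[simp] lemma leftEnd_zero : leftEnd m 0 = -1 := by simp [leftEnd]

@[simp] lemma primeNorm_leftEnd : primeNorm (leftEnd m) = 0 := by
  simp [primeNorm, leftEnd]

lemma leftEnd_mem_Ωε {ε : ℝ} (hε : 0 < ε) : leftEnd m ∈ d.Ωε ε := by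
  refine Or.inr (Or.inl (Or.inl ⟨by simp, by simp [hε.le], ?_⟩))
  simp [d.ρ_zero, hε]

lemma leftEnd_mem_frontier : leftEnd m ∈ frontier d.Ω₁ :=
  d.flat₁' ⟨leftEnd_zero, by simpa using d.hξ⟩

lemma norm_sub_leftEnd_le {x : ESp (m + 2)} (hx : x 0 = -1) : ‖x - leftEnd m‖ ≤ primeNorm x := by
  have h1 := norm_le_abs_add_primeNorm (x - leftEnd m)
  have h2 := primeNorm_add_le x (-leftEnd m)
  rw [primeNorm_neg, ← sub_eq_add_neg, primeNorm_leftEnd] at h2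
  rw [PiLp.sub_apply, leftEnd_zero, hx] at h1
  simpa using h1.trans (add_le_add le_rfl h2)

lemma notMem_of_mem_closure {s t : Set (ESp (m + 2))} (ht : IsOpen t) (hst : Disjoint s t)
    {x : ESp (m + 2)} (hx : x ∈ closure s) : x ∉ t :=
  fun h => (hst.closure_left ht).le_bot ⟨hx, h⟩

/-- On the boundary of either base domain, a solution on the dumbbell lives in the connector. -/
lemma lt_on_frontier {ε μ η : ℝ} {u : ESp (m + 2) → ℝ} (hu : UnitSolution (d.Ωε ε) μ u) (hη : 0 < η)
    (hQ : ∀ x ∈ d.Q ε, u x < η) :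
    (∀ x ∈ frontier d.Ω₁, u x < η) ∧ ∀ x ∈ frontier d.Ω₂, u x < η := by
  have key : ∀ x, x ∉ d.Ω₁ → x ∉ d.Ω₂ → u x < η := fun x h1 h2 => by
    by_cases hx : x ∈ d.Q ε
    · exact hQ x hx
    · rw [hu.zero x]
      · exact hη
      · rintro ((h | h) | h) <;> contradiction
  constructor <;> intro x hx
  · exact key x (by rw [d.open₁.frontier_eq] at hx; exact hx.2)
      (notMem_of_mem_closure d.open₂ d.disj (frontier_subset_closure hx))
  · exact key x (notMem_of_mem_closure d.open₁ d.disj.symm (frontier_subset_closure hx))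
      (by rw [d.open₂.frontier_eq] at hx; exact hx.2)

section family

variable {lam : ℝ} {g : ESp (m + 2) → ℝ} {μ : ℝ → ℝ} {u : ℝ → ESp (m + 2) → ℝ}

/-- The base domain `Ω₁` is connected as soon as it and the dumbbells carry positive
first eigenfunctions. -/
lemma isPreconnected_Ω₁ (hg : UnitSolution d.Ω₁ lam g)
    (hu : ∀ ε, 0 < ε → ε ≤ 1 → UnitSolution (d.Ωε ε) (μ ε) (u ε)) : IsPreconnected d.Ω₁ := by
  have hopen := (hu 1 one_pos le_rfl).isOpen
  obtain ⟨t₁, ht₁, hball₁⟩ := Metric.isOpen_iff.1 hopen _ (leftEnd_mem_Ωε (d := d) one_pos)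
  have hξ := d.hξ
  set t := min t₁ (min (3 * d.ξ) 1) with ht
  have ht0 : 0 < t := lt_min ht₁ (lt_min (by positivity) one_pos)
  have ht1 : t ≤ t₁ := min_le_left _ _
  have htξ : t ≤ 3 * d.ξ := (min_le_right _ _).trans (min_le_left _ _)
  have htone : t ≤ 1 := (min_le_right _ _).trans (min_le_right _ _)
  have hpn : ∀ x ∈ ball (leftEnd m) t, primeNorm x < 3 * d.ξ ∧ x 0 < 1 := fun x hx => by
    have hn : ‖x - leftEnd m‖ < t := by rw [← dist_eq_norm]; exact hx
    have h1 := primeNorm_le_add_norm_sub x (leftEnd m)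
    have h2 := abs_lt.1 ((abs_zero_coord_le_norm _).trans_lt hn)
    rw [PiLp.sub_apply, leftEnd_zero] at h2
    rw [primeNorm_leftEnd] at h1
    exact ⟨by linarith, by linarith [h2.2]⟩
  set H : Set (ESp (m + 2)) := ball (leftEnd m) t ∩ {x | x 0 < -1} with hH
  have hHΩ : H ⊆ d.Ω₁ := by
    rintro x ⟨hx, hx0⟩
    have hx0 : x 0 < -1 := hx0
    rcases hball₁ (ball_subset_ball ht1 hx) with (h | h) | h
    · exact h
    · linarith [lt_zero_coord_of_mem_Ω₂ h (hpn x hx).1]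
    · linarith [(le_zero_coord_of_mem_Q le_rfl one_pos h).1]
  have hHc : IsPreconnected H := by
    refine ((convex_ball _ _).inter ?_).isPreconnected
    exact convex_halfSpace_lt (f := fun x : ESp (m + 2) => x 0)
      ⟨fun _ _ => by simp, fun _ _ => by simp⟩ _
  have hΩH : d.Ω₁ ∩ ball (leftEnd m) t ⊆ H := fun x hx =>
    ⟨hx.2, zero_coord_lt_of_mem_Ω₁ hx.1 (hpn x hx.2).1⟩
  set C := d.profileBound + 1 with hC
  have hC0 : 0 < C := by have := d.profileBound_pos; positivity
  set ε := min 1 (t / C) with hε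
  have hε0 : 0 < ε := lt_min one_pos (by positivity)
  have hε1 : ε ≤ 1 := min_le_left _ _
  have hCε : C * ε ≤ t := by
    have : ε ≤ t / C := min_le_right _ _
    rw [le_div_iff₀ hC0] at this
    linarith
  have huε := hu ε hε0 hε1
  have hμ : μ ε < lam :=
    hg.eig_lt huε (subset_Ωε₁ ε) (leftEnd_mem_Ωε hε0) leftEnd_mem_frontier
  have main : ∀ a b : Set (ESp (m + 2)), IsOpen a → IsOpen b → d.Ω₁ ⊆ a ∪ b →
      d.Ω₁ ∩ (a ∩ b) = ∅ → H ⊆ a → d.Ω₁ ⊆ a := by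
    intro a b ha hb hab hdis hHa
    have hBo : IsOpen (d.Ω₁ ∩ b) := d.open₁.inter hb
    have hdisj : Disjoint (d.Ω₁ ∩ b) (d.Ω₁ ∩ a) := by
      rw [Set.disjoint_left]
      intro x hx hx'
      have : x ∈ d.Ω₁ ∩ (a ∩ b) := ⟨hx.1, hx'.2, hx.2⟩
      rw [hdis] at this
      exact this
    have hdball : Disjoint (d.Ω₁ ∩ b) (ball (leftEnd m) t) := by
      rw [Set.disjoint_left]
      intro x hx hx'
      exact Set.disjoint_left.1 hdisj hx ⟨hx.1, hHa (hΩH ⟨hx.1, hx'⟩)⟩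
    have hB : d.Ω₁ ∩ b = ∅ := by
      refine hg.eq_empty_of_frontier huε hμ hBo inter_subset_left
        (inter_subset_left.trans (subset_Ωε₁ ε)) fun x hx => huε.zero x ?_
      have hxc : x ∈ closure (d.Ω₁ ∩ b) := frontier_subset_closure hx
      have hxcΩ : x ∈ closure d.Ω₁ := closure_mono inter_subset_left hxc
      rw [hBo.frontier_eq] at hx
      rintro ((h | h) | h)
      · rcases hab h with h' | h'
        · exact notMem_of_mem_closure (d.open₁.inter ha) hdisj hxc ⟨h, h'⟩
        · exact hx.2 ⟨h, h'⟩
      · exact notMem_of_mem_closure d.open₂ d.disj hxcΩ h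
      · have h1 := primeNorm_lt_of_mem_Q hε0 h
        have h2 : x ∈ {x : ESp (m + 2) | x 0 = -1 ∧ primeNorm x < 3 * d.ξ} :=
          d.flat₁ ▸ ⟨hxcΩ, (le_zero_coord_of_mem_Q hε1 hε0 h).1, by linarith⟩
        refine notMem_of_mem_closure isOpen_ball hdball hxc ?_
        rw [mem_ball, dist_eq_norm]
        linarith [norm_sub_leftEnd_le h2.1]
    intro x hx
    rcases hab hx with h | h
    · exact h
    · exact (hB.subset ⟨hx, h⟩).elim
  rw [isPreconnected_iff_subset_of_disjoint]
  intro a b ha hb hab hdis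
  have hHab : H ∩ (a ∩ b) = ∅ := subset_eq_empty (inter_subset_inter_left _ hHΩ) hdis
  rcases isPreconnected_iff_subset_of_disjoint.1 hHc a b ha hb (hHΩ.trans hab) hHab with h | h
  · exact Or.inl (main a b ha hb hab hdis h)
  · exact Or.inr (main b a hb ha (by rwa [union_comm]) (by rwa [inter_comm b a]) h)

/-- As `ε → 0` the solutions become uniformly small on the connector. -/
lemma eventually_lt_on_Q (hg : UnitSolution d.Ω₁ lam g)
    (hu : ∀ ε, 0 < ε → ε ≤ 1 → UnitSolution (d.Ωε ε) (μ ε) (u ε)) {η : ℝ} (hη : 0 < η) :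
    ∀ᶠ ε in nhdsWithin (0 : ℝ) (Ioi 0), UnitSolution (d.Ωε ε) (μ ε) (u ε) ∧ μ ε ≤ lam ∧
      ∀ x ∈ d.Q ε, u ε x < η := by
  obtain ⟨r, hr, H⟩ := UnitSolution.exists_neck (m := m) hg.eig_nonneg d.hξ hη
  have hC0 : 0 < d.profileBound + 1 := by have := d.profileBound_pos; positivity
  have hlt : (0 : ℝ) < min 1 (r / (d.profileBound + 1)) := lt_min one_pos (by positivity)
  filter_upwards [Ioc_mem_nhdsGT hlt] with ε hε
  have hε1 : ε ≤ 1 := hε.2.trans (min_le_left _ _)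
  have hCε : (d.profileBound + 1) * ε ≤ r := by
    have : ε ≤ r / (d.profileBound + 1) := hε.2.trans (min_le_right _ _)
    rw [le_div_iff₀ hC0] at this
    linarith
  have huε := hu ε hε.1 hε1
  have hμ : μ ε < lam :=
    hg.eig_lt huε (subset_Ωε₁ ε) (leftEnd_mem_Ωε hε.1) leftEnd_mem_frontier
  refine ⟨huε, hμ.le, fun x hx => H _ _ _ huε hμ.le (fun y h1 h2 h3 h4 => huε.zero y
    (notMem_Ωε hε.1 h1 h2 (hCε.trans h3) h4)) x (le_zero_coord_of_mem_Q hε1 hε.1 hx).1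
    (le_zero_coord_of_mem_Q hε1 hε.1 hx).2 ?_⟩
  linarith [primeNorm_lt_of_mem_Q hε.1 hx]

/-- As `ε → 0`, the solutions on the dumbbells become proportional to `g` on `Ω₁`. -/
lemma tendsto_quotient_sub (hg : UnitSolution d.Ω₁ lam g)
    (hu : ∀ ε, 0 < ε → ε ≤ 1 → UnitSolution (d.Ωε ε) (μ ε) (u ε)) {x y : ESp (m + 2)}
    (hx : x ∈ d.Ω₁) (hy : y ∈ d.Ω₁) :
    Tendsto (fun ε => u ε x / g x - u ε y / g y) (nhdsWithin (0 : ℝ) (Ioi 0)) (nhds 0) := by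
  refine (isPreconnected_Ω₁ hg hu).induction₂
    (fun x y => Tendsto (fun ε => u ε x / g x - u ε y / g y) (nhdsWithin (0 : ℝ) (Ioi 0)) (nhds 0))
    ?_ ?_ ?_ hx hy
  · intro p hp
    obtain ⟨R, hR, hRΩ, H⟩ := hg.quotient_close hp
    filter_upwards [mem_nhdsWithin_of_mem_nhds (ball_mem_nhds p hR)] with x hx
    rw [Metric.tendsto_nhds]
    intro s hs
    obtain ⟨η, hη, H⟩ := H (s / 2) (half_pos hs)
    filter_upwards [eventually_lt_on_Q hg hu hη] with ε hε
    have := H _ _ _ hε.1 (subset_Ωε₁ ε) hε.2.1 (lt_on_frontier hε.1 hη hε.2.2).1 x hx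
    rw [dist_zero_right, Real.norm_eq_abs, abs_sub_comm]
    linarith
  · intro a b c _ _ _ h1 h2
    simpa using h1.add h2
  · intro a b _ _ h
    simpa using h.neg

end family

end Dumbbell

/-! ### Concentration of the maximum -/

/-- A continuous function has averages bounded by a pointwise bound plus an `L¹` error. -/
lemma avg_le_add_integral {f h : ESp k → ℝ} (hf : Continuous f)
    (hhi : Integrable h) (hh0 : ∀ y, 0 ≤ h y) {x : ESp k} {r θ : ℝ} (hr : 0 < r)
    (hle : ∀ y ∈ closedBall x r, f y ≤ h y + θ) :
    avg f x r ≤ θ + (r ^ k)⁻¹ * (∫ y, h y) / massK k := by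
  have hm := massK_pos (k := k)
  have h1 : ∫ z, f (x + r • z) * kerK z ≤ ∫ z, (h (x + r • z) + θ * kerK z) := by
    refine integral_mono (integrable_mul_kerK hf x r)
      ((integrable_affine hhi x hr).add (integrable_kerK.const_mul θ)) fun z => ?_
    by_cases hz : kerK z = 0
    · simpa [hz] using hh0 _
    · have h2 := hle _ (add_smul_mem_closedBall hr.le hz)
      have h3 := kerK_nonneg z
      have h4 := kerK_le_one z
      have h5 := hh0 (x + r • z)
      simp only
      nlinarith
  rw [integral_add (integrable_affine hhi x hr) (integrable_kerK.const_mul θ), integral_affine h x hr,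
    integral_const_mul, ← massK] at h1
  rw [avg, div_le_iff₀ hm, add_mul, div_mul_cancel₀ _ hm.ne']
  linarith

namespace Dumbbell

variable {m : ℕ} {d : Dumbbell m} {lam : ℝ} {g : ESp (m + 2) → ℝ} {μ : ℝ → ℝ}
  {u : ℝ → ESp (m + 2) → ℝ}

lemma tendsto_setIntegral_abs_sub (hg : UnitSolution d.Ω₁ lam g)
    (hu : ∀ ε, 0 < ε → ε ≤ 1 → UnitSolution (d.Ωε ε) (μ ε) (u ε)) {x₀ : ESp (m + 2)}
    (hx₀ : x₀ ∈ d.Ω₁) (hgx₀ : g x₀ = 1) :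
    Tendsto (fun ε => ∫ x in d.Ω₁, |u ε x - u ε x₀ * g x|) (nhdsWithin (0 : ℝ) (Ioi 0))
      (nhds 0) := by
  have hsol : ∀ᶠ ε in nhdsWithin (0 : ℝ) (Ioi 0), UnitSolution (d.Ωε ε) (μ ε) (u ε) := by
    filter_upwards [Ioc_mem_nhdsGT (zero_lt_one (α := ℝ))] with ε hε using hu ε hε.1 hε.2
  have h := tendsto_integral_filter_of_dominated_convergence (μ := volume.restrict d.Ω₁)
    (F := fun ε x => |u ε x - u ε x₀ * g x|) (f := fun _ => (0 : ℝ))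
    (l := nhdsWithin (0 : ℝ) (Ioi 0)) (fun _ => (2 : ℝ)) ?_ ?_ ?_ ?_
  · simpa using h
  · filter_upwards [hsol] with ε hε
    exact ((hε.continuous.sub (continuous_const.mul hg.continuous)).abs).aestronglyMeasurable
  · filter_upwards [hsol] with ε hε
    refine Eventually.of_forall fun x => ?_
    rw [Real.norm_eq_abs, abs_abs]
    calc |u ε x - u ε x₀ * g x| ≤ |u ε x| + |u ε x₀ * g x| := abs_sub _ _
      _ ≤ 1 + 1 * 1 := by
        rw [abs_mul]
        exact add_le_add (hε.abs_le_one x) (mul_le_mul (hε.abs_le_one x₀) (hg.abs_le_one x)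
          (abs_nonneg _) zero_le_one)
      _ = 2 := by norm_num
  · exact integrableOn_const d.bounded₁.measure_lt_top.ne
  · filter_upwards [ae_restrict_mem d.open₁.measurableSet] with x hx
    have h1 := ((tendsto_quotient_sub hg hu hx hx₀).const_mul (g x)).abs
    simp only [mul_zero, abs_zero] at h1
    refine h1.congr fun ε => ?_
    have := (hg.pos x hx).ne'
    rw [hgx₀]
    congr 1
    field_simp

/-- As `ε → 0`, the solutions on the dumbbells are `L¹`-close to multiples of `g`. -/
lemma eventually_integral_abs_sub_le (hg : UnitSolution d.Ω₁ lam g) (hlam : lam < dirEig1 d.Ω₂)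
    (hu : ∀ ε, 0 < ε → ε ≤ 1 → UnitSolution (d.Ωε ε) (μ ε) (u ε)) {x₀ : ESp (m + 2)}
    (hx₀ : x₀ ∈ d.Ω₁) (hgx₀ : g x₀ = 1) {s : ℝ} (hs : 0 < s) :
    ∀ᶠ ε in nhdsWithin (0 : ℝ) (Ioi 0), ∫ x, |u ε x - u ε x₀ * g x| ≤ s := by
  have hs3 : 0 < s / 3 := by positivity
  obtain ⟨η₁, hη₁, H⟩ := UnitSolution.setIntegral_le d.open₂ d.bounded₂ hlam
    (fun w h1 h2 h3 => dirEig1_mul_integral_sq_le d.open₂ h1 h2 h3) hs3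
  set K : Set (ESp (m + 2)) := closedBall 0 (1 + (d.profileBound + 1)) with hK
  have hKfin : volume K ≠ ⊤ := measure_closedBall_lt_top.ne
  obtain ⟨η₂, hη₂, hη₂K, -⟩ := exists_pos_mul_le hs3 (volume.real K)
  have hη : 0 < min η₁ η₂ := lt_min hη₁ hη₂
  filter_upwards [eventually_lt_on_Q hg hu hη, Ioc_mem_nhdsGT (zero_lt_one (α := ℝ)),
    (tendsto_setIntegral_abs_sub hg hu hx₀ hgx₀).eventually (Iio_mem_nhds hs3)]
    with ε ⟨hsol, hμ, hQ⟩ hε hΩ₁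
  have hΩ₂ := H _ _ _ hsol (subset_Ωε₂ ε) hμ (lt_on_frontier hsol hη₁
    fun x hx => (hQ x hx).trans_le (min_le_left _ _)).2
  have hI : Integrable fun x => |u ε x - u ε x₀ * g x| :=
    (hsol.integrable.sub (hg.integrable.const_mul _)).abs
  have hI1 : Integrable (d.Ω₁.indicator fun x => |u ε x - u ε x₀ * g x|) :=
    hI.indicator d.open₁.measurableSet
  have hI2 : Integrable (d.Ω₂.indicator (u ε)) := hsol.integrable.indicator d.open₂.measurableSet
  have hI3 : Integrable (K.indicator fun _ => η₂) :=
    (integrable_indicator_iff measurableSet_closedBall).2 (integrableOn_const hKfin)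
  have hpt : ∀ x, |u ε x - u ε x₀ * g x| ≤ d.Ω₁.indicator (fun x => |u ε x - u ε x₀ * g x|) x +
      d.Ω₂.indicator (u ε) x + K.indicator (fun _ => η₂) x := by
    intro x
    have hK0 : 0 ≤ K.indicator (fun _ => η₂) x := indicator_nonneg (fun _ _ => hη₂.le) x
    have h20 : 0 ≤ d.Ω₂.indicator (u ε) x := indicator_nonneg (fun _ _ => hsol.nonneg _) x
    by_cases h1 : x ∈ d.Ω₁
    · rw [indicator_of_mem h1]; linarith
    rw [indicator_of_notMem h1, hg.zero x h1, mul_zero, sub_zero, abs_of_nonneg (hsol.nonneg x)]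
    by_cases h2 : x ∈ d.Ω₂
    · rw [indicator_of_mem h2]; linarith
    by_cases h3 : x ∈ d.Q ε
    · have hxK : x ∈ K := by
        rw [hK, mem_closedBall_zero_iff]
        have a1 := abs_le.2 (le_zero_coord_of_mem_Q hε.2 hε.1 h3)
        have a2 := primeNorm_lt_of_mem_Q hε.1 h3
        have a3 : (d.profileBound + 1) * ε ≤ (d.profileBound + 1) * 1 := by
          have := d.profileBound_pos
          gcongr
          exact hε.2
        linarith [norm_le_abs_add_primeNorm x]
      rw [indicator_of_mem hxK]
      linarith [(hQ x h3).trans_le (min_le_right _ _)]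
    · rw [hsol.zero x (by rintro ((h | h) | h) <;> contradiction)]
      linarith
  have hsum := integral_mono hI ((hI1.add hI2).add hI3) hpt
  have he : ∫ x, (d.Ω₁.indicator (fun x => |u ε x - u ε x₀ * g x|) +
      d.Ω₂.indicator (u ε) + K.indicator fun _ => η₂) x =
      (∫ x in d.Ω₁, |u ε x - u ε x₀ * g x|) + (∫ x in d.Ω₂, u ε x) + η₂ * volume.real K := by
    rw [integral_add' (hI1.add hI2) hI3, integral_add' hI1 hI2,
      integral_indicator d.open₁.measurableSet, integral_indicator d.open₂.measurableSet,
      integral_indicator measurableSet_closedBall, setIntegral_const, smul_eq_mul,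
      mul_comm η₂]
  refine hsum.trans ?_
  have hΩ₁ : ∫ x in d.Ω₁, |u ε x - u ε x₀ * g x| < s / 3 := hΩ₁
  rw [he]
  linarith

/-- As `ε → 0`, the solutions on the dumbbells stay below one away from the maximum point
of `g`. -/
lemma eventually_lt_one (hg : UnitSolution d.Ω₁ lam g) (hlam : lam < dirEig1 d.Ω₂)
    (hu : ∀ ε, 0 < ε → ε ≤ 1 → UnitSolution (d.Ωε ε) (μ ε) (u ε)) {x₀ : ESp (m + 2)}
    (hx₀ : x₀ ∈ d.Ω₁) (hgx₀ : g x₀ = 1) (huniq : ∀ y, g y = 1 → y = x₀) {δ : ℝ} (hδ : 0 < δ) :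
    ∀ᶠ ε in nhdsWithin (0 : ℝ) (Ioi 0), ∀ y ∉ ball x₀ δ, u ε y < 1 := by
  obtain ⟨θ, hθ0, hθ1, hθ⟩ : ∃ θ, 0 ≤ θ ∧ θ < 1 ∧ ∀ y ∉ ball x₀ (δ / 2), g y ≤ θ := by
    have hKc : IsCompact (closure d.Ω₁ \ ball x₀ (δ / 2)) :=
      d.bounded₁.isCompact_closure.diff isOpen_ball
    rcases (closure d.Ω₁ \ ball x₀ (δ / 2)).eq_empty_or_nonempty with he | hne
    · refine ⟨0, le_rfl, one_pos, fun y hy => (hg.zero y fun hyΩ => ?_).le⟩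
      exact he.subset ⟨subset_closure hyΩ, hy⟩
    · obtain ⟨z, hz, hmax⟩ := hKc.exists_isMaxOn hne hg.continuous.continuousOn
      refine ⟨g z, hg.nonneg z, lt_of_le_of_ne (hg.le_one z) fun h => hz.2 ?_, fun y hy => ?_⟩
      · rw [huniq z h]; exact mem_ball_self (by positivity)
      · by_cases hyΩ : y ∈ d.Ω₁
        · exact hmax ⟨subset_closure hyΩ, hy⟩
        · rw [hg.zero y hyΩ]; exact hg.nonneg z
  have hgap : 0 < (1 - θ) / 3 := by linarith
  obtain ⟨q, hq, hq1, -⟩ := exists_pos_mul_le hgap (lam * meanC (m + 2))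
  set r := min (δ / 2) (min q 1) with hr
  have hr0 : 0 < r := lt_min (by positivity) (lt_min hq one_pos)
  have hrδ : r ≤ δ / 2 := min_le_left _ _
  have hrq : r ≤ q := (min_le_right _ _).trans (min_le_left _ _)
  have hr1 : r ≤ 1 := (min_le_right _ _).trans (min_le_right _ _)
  have hm := massK_pos (k := m + 2)
  have hC : 0 ≤ lam * meanC (m + 2) := mul_nonneg hg.eig_nonneg meanC_nonneg
  have hs : 0 < (1 - θ) / 3 * massK (m + 2) * r ^ (m + 2) := by positivity
  filter_upwards [eventually_integral_abs_sub_le hg hlam hu hx₀ hgx₀ hs,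
    eventually_lt_on_Q hg hu one_pos] with ε hT ⟨hsol, hμ, _⟩ y hy
  have hInt : Integrable fun x => |u ε x - u ε x₀ * g x| :=
    (hsol.integrable.sub (hg.integrable.const_mul _)).abs
  have h1 := hsol.le_avg hμ y hr0.le
  have h2 := avg_le_add_integral (θ := θ) hsol.continuous hInt
    (fun _ => abs_nonneg _) hr0 (x := y) fun z hz => by
      have hz' : z ∉ ball x₀ (δ / 2) := fun h => hy (mem_ball.2 (by
        have := dist_triangle y z x₀
        rw [dist_comm y z] at this
        linarith [mem_ball.1 h, mem_closedBall.1 hz]))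
      have a1 := le_abs_self (u ε z - u ε x₀ * g z)
      have a2 : u ε x₀ * g z ≤ 1 * g z :=
        mul_le_mul_of_nonneg_right (hsol.le_one x₀) (hg.nonneg z)
      linarith [hθ z hz']
  have h3 : (r ^ (m + 2))⁻¹ * (∫ x, |u ε x - u ε x₀ * g x|) / massK (m + 2) ≤ (1 - θ) / 3 := by
    rw [div_le_iff₀ hm, inv_mul_le_iff₀ (by positivity)]
    linarith
  have h4 : lam * meanC (m + 2) * r ^ 2 ≤ (1 - θ) / 3 := by
    calc lam * meanC (m + 2) * r ^ 2 ≤ lam * meanC (m + 2) * q := by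
          gcongr
          nlinarith
      _ ≤ _ := by linarith
  linarith

end Dumbbell

end

/-- For the dumbbell family `Ω_ε` with `Ω₂` simply connected and
`λ₁(Ω₁) < λ₁(Ω₂)`, if the positive `L²`-normalized first Dirichlet eigenfunction of `Ω₁`
has a unique maximum point `x₀`, then for every `δ > 0` there is `ε' > 0` such that for all
`0 < ε ≤ ε'` the set of maximum points of the positive `L²`-normalized first Dirichlet
eigenfunction of `Ω_ε` is contained in the open ball `B(x₀, δ)`. -/
theorem stmt0 (m : ℕ) (d : Dumbbell m)
    (hsc₂ : SimplyConnectedSpace ↥d.Ω₂)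
    (hlam : dirEig1 d.Ω₁ < dirEig1 d.Ω₂)
    (φ₀ : ESp (m + 2) → ℝ)
    (hφ₀ : IsFirstDirEigenfun d.Ω₁ φ₀)
    (hφ₀pos : ∀ x ∈ d.Ω₁, 0 < φ₀ x)
    (hφ₀norm : (∫ x in d.Ω₁, φ₀ x ^ 2) = 1)
    (x₀ : ESp (m + 2)) (hx₀ : x₀ ∈ d.Ω₁)
    (hx₀max : φ₀ x₀ = sSup (φ₀ '' d.Ω₁))
    (hx₀uniq : ∀ y ∈ d.Ω₁, φ₀ y = sSup (φ₀ '' d.Ω₁) → y = x₀)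
    (φ : ℝ → ESp (m + 2) → ℝ)
    (hφ : ∀ ε > (0 : ℝ), IsFirstDirEigenfun (d.Ωε ε) (φ ε))
    (hφpos : ∀ ε > (0 : ℝ), ∀ x ∈ d.Ωε ε, 0 < φ ε x)
    (hφnorm : ∀ ε > (0 : ℝ), (∫ x in d.Ωε ε, (φ ε x) ^ 2) = 1) :
    ∀ δ > (0 : ℝ), ∃ ε' > (0 : ℝ), ∀ ε, 0 < ε → ε ≤ ε' →
      {x ∈ d.Ωε ε | φ ε x = sSup (φ ε '' d.Ωε ε)} ⊆ Metric.ball x₀ δ := by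
  intro δ hδ
  obtain ⟨M, hM, hMs, hg⟩ := hφ₀.unitSolution d.bounded₁ hφ₀pos
  have hu : ∀ ε, 0 < ε → ε ≤ 1 → UnitSolution (d.Ωε ε) (dirEig1 (d.Ωε ε))
      ((d.Ωε ε).indicator fun x => (sSup (φ ε '' d.Ωε ε))⁻¹ * φ ε x) := fun ε h0 h1 => by
    obtain ⟨N, -, rfl, h⟩ := (hφ ε h0).unitSolution (Dumbbell.isBounded_Ωε h0 h1) (hφpos ε h0)
    exact h
  have hgx₀ : d.Ω₁.indicator (fun x => M⁻¹ * φ₀ x) x₀ = 1 := by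
    rw [indicator_of_mem hx₀, hx₀max, ← hMs, inv_mul_cancel₀ hM.ne']
  have huniq : ∀ y, d.Ω₁.indicator (fun x => M⁻¹ * φ₀ x) y = 1 → y = x₀ := fun y hy => by
    by_cases hyΩ : y ∈ d.Ω₁
    · rw [indicator_of_mem hyΩ, inv_mul_eq_one₀ hM.ne'] at hy
      exact hx₀uniq y hyΩ (hy ▸ hMs)
    · rw [indicator_of_notMem hyΩ] at hy
      exact absurd hy zero_ne_one
  obtain ⟨ε', hε', hsub⟩ := mem_nhdsGT_iff_exists_Ioc_subset.1
    (Dumbbell.eventually_lt_one hg hlam hu hx₀ hgx₀ huniq hδ)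
  refine ⟨ε', hε', fun ε h0 h1 x hx => by_contra fun hxδ => ?_⟩
  have hlt := hsub ⟨h0, h1⟩ x hxδ
  have hpos : 0 < sSup (φ ε '' d.Ωε ε) := hx.2 ▸ hφpos ε h0 x hx.1
  rw [indicator_of_mem hx.1, hx.2, inv_mul_cancel₀ hpos.ne'] at hlt
  exact lt_irrefl _ hlt
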